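/- arXiv:0903.3839 — 2 statements merged into one kernel-verified Lean document; each statement's English description precedes it below -/
import Mathlib

section
/- Let D be a reduced essential central hyperplane arrangement in ℂ³ of degree d > 3 such that every 1-dimensional edge V satisfies μ_red(V) ≤ 3 (i.e. the multiplicity of D at every point x ≠ 0 is at most 3). Let j be an integer with 2/3 < j/d < 1 and set α = j/d. Then α ∈ JC(D) if and only if there exists a nonzero homogeneous polynomial g ∈ ℂ[x,y,z] of degree j−3 vanishing on every 1-dimensional edge V with μ_red(V) = 3. (Statement (0.1).) -/
open MeasureTheory
open scoped Classical

noncomputable section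

/-- A central hyperplane arrangement (with multiplicities) in `ℂ^n`, given by a finite
nonempty family of pairwise non-proportional nonzero linear forms `g i` with
multiplicities `m i ≥ 1`. -/
structure Arrangement (n : ℕ) where
  ι : Type
  fintypeι : Fintype ι
  nonemptyι : Nonempty ι
  g : ι → ((Fin n → ℂ) →ₗ[ℂ] ℂ)
  m : ι → ℕ
  g_ne : ∀ i, g i ≠ 0
  m_pos : ∀ i, 0 < m i
  nonproportional : ∀ i j : ι, i ≠ j → ∀ c : ℂ, g i ≠ c • g j

attribute [instance] Arrangement.fintypeι

namespace Arrangement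

variable {n : ℕ}

/-- The defining polynomial `f = ∏ i, g i ^ m i` of the arrangement, as a function. -/
def f (D : Arrangement n) (x : Fin n → ℂ) : ℂ :=
  ∏ i, D.g i x ^ D.m i

/-- The degree `d = ∑ i, m i` of the arrangement. -/
def degree (D : Arrangement n) : ℕ := ∑ i, D.m i

/-- The arrangement is essential: the intersection of its hyperplanes is `{0}`. -/
def Essential (D : Arrangement n) : Prop :=
  (⨅ i, LinearMap.ker (D.g i)) = ⊥

/-- The arrangement is reduced: all multiplicities are `1`. -/
def Reduced (D : Arrangement n) : Prop := ∀ i, D.m i = 1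

/-- The set of edges `S(D)`: intersections of nonempty subfamilies of the hyperplanes. -/
def edges (D : Arrangement n) : Set (Submodule ℂ (Fin n → ℂ)) :=
  {V | ∃ I : Set D.ι, I.Nonempty ∧ V = ⨅ i ∈ I, LinearMap.ker (D.g i)}

/-- The codimension `γ(V)` of an edge. -/
def gamma (_D : Arrangement n) (V : Submodule ℂ (Fin n → ℂ)) : ℕ :=
  n - Module.finrank ℂ V

/-- The multiplicity `μ(V) = ∑_{i : V ⊆ D_i} m i` of an edge. -/
def mu (D : Arrangement n) (V : Submodule ℂ (Fin n → ℂ)) : ℕ :=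
  ∑ i ∈ Finset.univ.filter fun i => V ≤ LinearMap.ker (D.g i), D.m i

/-- The reduced multiplicity `μ_red(V) = #{i : V ⊆ D_i}` of an edge. -/
def muRed (D : Arrangement n) (V : Submodule ℂ (Fin n → ℂ)) : ℕ :=
  (Finset.univ.filter fun i => V ≤ LinearMap.ker (D.g i)).card

end Arrangement

/-- `α` is a jumping coefficient of (the divisor of) `f` at the point `x`: there is a
function `g` holomorphic near `x` with `|g|²·|f|^(−2β)` locally integrable at `x` for all
`0 < β < α`, while `|g|²·|f|^(−2α)` is not integrable on any neighborhood of `x`. -/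
def JumpingAtOf {k : ℕ} (f : (Fin k → ℂ) → ℂ) (α : ℝ) (x : Fin k → ℂ) : Prop :=
  ∃ (U : Set (Fin k → ℂ)) (g : (Fin k → ℂ) → ℂ), U ∈ nhds x ∧ DifferentiableOn ℂ g U ∧
    (∀ β : ℝ, 0 < β → β < α →
      ∃ W ∈ nhds x, IntegrableOn (fun y => ‖g y‖ ^ 2 * ‖f y‖ ^ (-2 * β)) W) ∧
    ∀ W ∈ nhds x, ¬ IntegrableOn (fun y => ‖g y‖ ^ 2 * ‖f y‖ ^ (-2 * α)) W

/-- The set `JC(D)` of jumping coefficients of the arrangement `D`. -/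
def Arrangement.JC {n : ℕ} (D : Arrangement n) : Set ℝ :=
  {α | 0 < α ∧ ∃ x : Fin n → ℂ, JumpingAtOf D.f α x}

theorem integrableOn_ball_norm_rpow_neg {p : ℝ} (hp : p < 2) (r : ℝ) :
    IntegrableOn (fun z : ℂ => ‖z‖ ^ (-p)) (Metric.ball 0 r) := by
  refine integrableOn_ball_of_norm_le_rpow (μ := volume) (C := 1) (α := p) ?_ ?_ ?_ ?_
  · simp [Complex.finrank_real_complex]
  · simpa [Complex.finrank_real_complex] using hp
  · filter_upwards with z
    rw [one_mul, Real.norm_of_nonneg (by positivity)]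
  · exact (measurable_norm.pow_const _).aestronglyMeasurable

theorem integrableOn_ball_prod_norm_rpow_neg {p : ℝ} (hp : p < 2) (r : ℝ) :
    IntegrableOn (fun z : Fin 3 → ℂ => ∏ i, ‖z i‖ ^ (-p)) (Metric.ball 0 r) := by
  rcases le_or_gt r 0 with hr | hr
  · simp [Metric.ball_eq_empty.2 hr]
  have h := Integrable.fintype_prod (ι := Fin 3) (𝕜 := ℝ)
    (f := fun _ (z : ℂ) => ‖z‖ ^ (-p))
    (μ := fun _ => volume.restrict (Metric.ball (0 : ℂ) r))
    (fun _ => integrableOn_ball_norm_rpow_neg hp r)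
  rw [← Measure.restrict_pi_pi] at h
  rwa [IntegrableOn, ball_pi _ hr]

theorem integrableOn_ball_prod_norm_apply_rpow_neg (L : (Fin 3 → ℂ) ≃L[ℂ] (Fin 3 → ℂ)) {p : ℝ}
    (hp : p < 2) (r : ℝ) :
    IntegrableOn (fun y : Fin 3 → ℂ => ∏ i, ‖L y i‖ ^ (-p)) (Metric.ball 0 r) := by
  have hmap : (Measure.map L (volume : Measure (Fin 3 → ℂ))).IsAddHaarMeasure :=
    L.isAddHaarMeasure_map _
  have hsmul := Measure.isAddLeftInvariant_eq_smul
    (Measure.map L (volume : Measure (Fin 3 → ℂ))) volume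
  have h := (integrableOn_ball_prod_norm_rpow_neg hp (‖(L : (Fin 3 → ℂ) →L[ℂ] (Fin 3 → ℂ))‖ * r + 1))
  have h2 : IntegrableOn (fun z : Fin 3 → ℂ => ∏ i, ‖z i‖ ^ (-p))
      (Metric.ball 0 (‖(L : (Fin 3 → ℂ) →L[ℂ] (Fin 3 → ℂ))‖ * r + 1))
      (Measure.map L (volume : Measure (Fin 3 → ℂ))) := by
    rw [hsmul, IntegrableOn, Measure.restrict_smul]
    exact Integrable.smul_measure h (by simp)
  have h2 := (L.toHomeomorph.measurableEmbedding.integrableOn_map_iff).1 h2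
  refine h2.mono_set ?_
  intro y hy
  rw [Set.mem_preimage, mem_ball_zero_iff]
  rw [mem_ball_zero_iff] at hy
  have := (L : (Fin 3 → ℂ) →L[ℂ] (Fin 3 → ℂ)).le_opNorm y
  have h3 : ‖(L : (Fin 3 → ℂ) →L[ℂ] (Fin 3 → ℂ))‖ * ‖y‖ ≤
    ‖(L : (Fin 3 → ℂ) →L[ℂ] (Fin 3 → ℂ))‖ * r := by gcongr
  exact lt_of_le_of_lt (this.trans h3) (by linarith)

open scoped Pointwise in
theorem not_integrableOn_ball_of_homogeneous {E : Type*} [NormedAddCommGroup E] [NormedSpace ℝ E]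
    [FiniteDimensional ℝ E] [MeasurableSpace E] [BorelSpace E] (μ : Measure E) [μ.IsAddHaarMeasure]
    {F : E → ℝ} (hnn : ∀ y, 0 ≤ F y)
    (hF : ∀ t : ℝ, 0 < t → ∀ y, F (t • y) = (t ^ Module.finrank ℝ E)⁻¹ * F y)
    (hc : ∀ y, F y ≠ 0 → ContinuousAt F y) {y₀ : E} (hy₀ : y₀ ≠ 0) (hFy : F y₀ ≠ 0)
    {r : ℝ} (hr : 0 < r) : ¬ IntegrableOn F (Metric.ball 0 r) μ := by
  intro hint
  have h1 := Measure.setIntegral_comp_smul_of_pos μ F (Metric.ball 0 r) (R := 2⁻¹) (by norm_num)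
  have hball : (2⁻¹ : ℝ) • Metric.ball (0 : E) r = Metric.ball 0 (r / 2) := by
    rw [smul_ball (by norm_num), smul_zero]
    norm_num
    ring_nf
  rw [hball] at h1
  simp_rw [hF 2⁻¹ (by norm_num), integral_const_mul] at h1
  have h2 : ∫ x in Metric.ball 0 r, F x ∂μ = ∫ x in Metric.ball 0 (r / 2), F x ∂μ := by
    have : ((2⁻¹ : ℝ) ^ Module.finrank ℝ E)⁻¹ ≠ 0 := by positivity
    exact mul_left_cancel₀ this (by simpa using h1)
  have hsub : Metric.ball (0 : E) (r / 2) ⊆ Metric.ball 0 r := Metric.ball_subset_ball (by linarith)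
  have h3 : ∫ x in Metric.ball 0 r \ Metric.ball 0 (r / 2), F x ∂μ = 0 := by
    rw [setIntegral_sdiff Metric.isOpen_ball.measurableSet hint hsub, h2, sub_self]
  rw [setIntegral_eq_zero_iff_of_nonneg_ae (Filter.Eventually.of_forall hnn)
    (hint.mono_set Set.sdiff_subset)] at h3
  set t : ℝ := 3 * r / 4 / ‖y₀‖
  have hn : 0 < ‖y₀‖ := norm_pos_iff.2 hy₀
  have ht : 0 < t := by positivity
  have hFt : F (t • y₀) ≠ 0 := by
    rw [hF t ht]
    positivity
  have hnorm : ‖t • y₀‖ = 3 * r / 4 := by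
    rw [norm_smul, Real.norm_of_nonneg ht.le]
    simp only [t]
    field_simp
  have hmem : ∀ᶠ y in nhds (t • y₀), F y ≠ 0 ∧ y ∈ Metric.ball 0 r \ Metric.ball 0 (r / 2) := by
    refine ((hc _ hFt).eventually_ne hFt).and ?_
    have : ∀ᶠ y in nhds (t • y₀), r / 2 < ‖y‖ ∧ ‖y‖ < r := by
      refine (continuous_norm.continuousAt.eventually_const_lt ?_).and
        (continuous_norm.continuousAt.eventually_lt_const ?_) <;> simp only [hnorm] <;> linarith
    filter_upwards [this] with y hy
    simp only [Set.mem_sdiff, mem_ball_zero_iff, not_lt]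
    exact ⟨hy.2, hy.1.le⟩
  have hpos := Measure.measure_pos_of_mem_nhds μ hmem
  rw [Filter.EventuallyEq, ae_restrict_iff' 
    (Metric.isOpen_ball.measurableSet.diff Metric.isOpen_ball.measurableSet)] at h3
  refine hpos.ne' (measure_mono_null ?_ h3)
  intro y hy h
  exact hy.1 (h hy.2)

theorem not_integrableOn_ball_norm_pow_four_inv {r : ℝ} (hr : 0 < r) :
    ¬ IntegrableOn (fun u : ℂ × ℂ => (‖u‖ ^ 4)⁻¹) (Metric.ball 0 r) := by
  have hfr : Module.finrank ℝ (ℂ × ℂ) = 4 := by simp [Complex.finrank_real_complex]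
  have hvol : (volume : Measure (ℂ × ℂ)).IsAddHaarMeasure :=
    Measure.prod.instIsAddHaarMeasure volume volume
  refine not_integrableOn_ball_of_homogeneous volume (fun y => by positivity) ?_ ?_
    (y₀ := ((1 : ℂ), (0 : ℂ))) (by simp) (by simp) hr
  · intro t ht y
    rw [hfr, norm_smul, Real.norm_of_nonneg ht.le, mul_pow, mul_inv]
  · intro y hy
    have : ‖y‖ ^ 4 ≠ 0 := fun h => hy (by simp [h])
    exact ContinuousAt.inv₀ (by fun_prop) this

theorem not_integrableOn_of_norm_fst_pow_four_inv_le (L : (Fin 3 → ℂ) ≃L[ℂ] (ℂ × ℂ) × ℂ)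
    {x : Fin 3 → ℂ} (hx : (L x).1 = 0) {W : Set (Fin 3 → ℂ)} (hW : W ∈ nhds x)
    {F : (Fin 3 → ℂ) → ℝ} {c : ℝ} (hc : 0 < c)
    (hF : ∀ᵐ y, y ∈ W → c * (‖(L y).1‖ ^ 4)⁻¹ ≤ F y) : ¬ IntegrableOn F W := by
  intro hint
  have hWL : L.symm ⁻¹' W ∈ nhds (L x) := L.symm.continuous.continuousAt.preimage_mem_nhds (by simpa)
  obtain ⟨r, hr, hrW⟩ := Metric.mem_nhds_iff.1 hWL
  set B := Metric.ball (L x) r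
  have hsub : L ⁻¹' B ⊆ W := by
    intro y hy
    simpa using hrW hy
  have hmeas : MeasurableSet (L ⁻¹' B) := L.continuous.measurable Metric.isOpen_ball.measurableSet
  have hint1 : IntegrableOn (fun y => (‖(L y).1‖ ^ 4)⁻¹) (L ⁻¹' B) := by
    refine Integrable.mono' ((hint.mono_set hsub).const_mul c⁻¹) ?_ ?_
    · have : Measurable fun y => (‖(L y).1‖ ^ 4)⁻¹ := by
        have h1 : Measurable fun y => ‖(L y).1‖ :=
          (continuous_norm.comp (continuous_fst.comp L.continuous)).measurable
        exact (h1.pow_const 4).inv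
      exact this.aestronglyMeasurable
    · filter_upwards [ae_restrict_of_ae hF, ae_restrict_mem hmeas] with y hy hyB
      rw [Real.norm_of_nonneg (by positivity), ← div_eq_inv_mul, le_div_iff₀ hc, mul_comm]
      exact hy (hsub hyB)
  have hint2 : IntegrableOn (fun q : (ℂ × ℂ) × ℂ => (‖q.1‖ ^ 4)⁻¹) B
      (Measure.map L (volume : Measure (Fin 3 → ℂ))) :=
    (L.toHomeomorph.measurableEmbedding.integrableOn_map_iff).2 hint1
  have hmap : (Measure.map L (volume : Measure (Fin 3 → ℂ))).IsAddHaarMeasure :=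
    L.isAddHaarMeasure_map _
  have hvol₂ : (volume : Measure (ℂ × ℂ)).IsAddHaarMeasure :=
    Measure.prod.instIsAddHaarMeasure volume volume
  have hvol₃ : (volume : Measure ((ℂ × ℂ) × ℂ)).IsAddHaarMeasure :=
    Measure.prod.instIsAddHaarMeasure volume volume
  have hsmul := Measure.isAddLeftInvariant_eq_smul
    (volume : Measure ((ℂ × ℂ) × ℂ)) (Measure.map L (volume : Measure (Fin 3 → ℂ)))
  have hint3 : IntegrableOn (fun q : (ℂ × ℂ) × ℂ => (‖q.1‖ ^ 4)⁻¹) B volume := by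
    rw [hsmul, IntegrableOn, Measure.restrict_smul]
    exact Integrable.smul_measure hint2 (by simp)
  have hB : B = Metric.ball (L x).1 r ×ˢ Metric.ball (L x).2 r :=
    (ball_prod_same (L x).1 (L x).2 r).symm
  rw [hB, hx, IntegrableOn, Measure.volume_eq_prod, ← Measure.prod_restrict] at hint3
  have h4 := hint3.prod_left_ae
  have hne : (ae (volume.restrict (Metric.ball (L x).2 r))).NeBot := by
    rw [ae_neBot, Ne, Measure.restrict_eq_zero]
    exact (Metric.measure_ball_pos _ _ hr).ne'
  obtain ⟨w, hw⟩ := h4.exists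
  exact not_integrableOn_ball_norm_pow_four_inv hr hw

theorem LinearMap.exists_apply_eq_zero_one {φ ψ : (Fin 3 → ℂ) →ₗ[ℂ] ℂ} (h : ∀ c : ℂ, ψ ≠ c • φ) :
    ∃ u, φ u = 0 ∧ ψ u = 1 := by
  by_contra! hcon
  have hker : ∀ y, φ y = 0 → ψ y = 0 := by
    intro y hy
    by_contra hne
    exact hcon ((ψ y)⁻¹ • y) (by simp [hy]) (by simp [hne])
  rcases eq_or_ne φ 0 with h0 | h0
  · refine h 0 ?_
    ext1
    simp only [zero_smul]
    ext
    simp [hker _ (by simp [h0])]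
  · obtain ⟨z, hz⟩ : ∃ z, φ z ≠ 0 := by
      by_contra! hz
      exact h0 (LinearMap.ext hz)
    refine h (ψ z / φ z) (LinearMap.ext fun y => ?_)
    have := hker (y - (φ y / φ z) • z) (by simp [hz])
    simp only [map_sub, map_smul, smul_eq_mul, sub_eq_zero] at this
    rw [this, LinearMap.smul_apply, smul_eq_mul]
    ring

namespace Arrangement

/-- The hyperplanes `a`, `b`, `c` are distinct and contain a common line. -/
def Concurrent (D : Arrangement 3) (a b c : D.ι) : Prop :=
  a ≠ b ∧ a ≠ c ∧ b ≠ c ∧ ∀ y, D.g a y = 0 → D.g b y = 0 → D.g c y = 0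

theorem exists_dual_pair (D : Arrangement 3) {a b : D.ι} (hab : a ≠ b) :
    ∃ u v, D.g a u = 1 ∧ D.g b u = 0 ∧ D.g a v = 0 ∧ D.g b v = 1 := by
  obtain ⟨v, hv⟩ := LinearMap.exists_apply_eq_zero_one (D.nonproportional b a hab.symm)
  obtain ⟨u, hu⟩ := LinearMap.exists_apply_eq_zero_one (D.nonproportional a b hab)
  exact ⟨u, v, hu.2, hu.1, hv.1, hv.2⟩

theorem finrank_ker_inf_ker (D : Arrangement 3) {a b : D.ι} (hab : a ≠ b) :
    Module.finrank ℂ (LinearMap.ker (D.g a) ⊓ LinearMap.ker (D.g b) :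
      Submodule ℂ (Fin 3 → ℂ)) = 1 := by
  obtain ⟨u, v, h1, h2, h3, h4⟩ := D.exists_dual_pair hab
  have hsurj : Function.Surjective ((D.g a).prod (D.g b)) := by
    rintro ⟨s, t⟩
    exact ⟨s • u + t • v, by simp [h1, h2, h3, h4]⟩
  have h := LinearMap.finrank_range_add_finrank_ker ((D.g a).prod (D.g b))
  rw [LinearMap.range_eq_top.2 hsurj, LinearMap.ker_prod] at h
  simp at h
  omega

theorem ker_inf_ker_mem_edges (D : Arrangement 3) (a b : D.ι) :
    LinearMap.ker (D.g a) ⊓ LinearMap.ker (D.g b) ∈ D.edges :=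
  ⟨{a, b}, by simp, by rw [iInf_pair]⟩

theorem eq_of_concurrent (D : Arrangement 3)
    (hmult : ∀ V ∈ D.edges, Module.finrank ℂ V = 1 → D.muRed V ≤ 3) {a b c e : D.ι}
    (hc : D.Concurrent a b c) (he : D.Concurrent a b e) : c = e := by
  by_contra hne
  obtain ⟨hab, hac, hbc, hc⟩ := hc
  obtain ⟨-, hae, hbe, he⟩ := he
  have h := hmult _ (D.ker_inf_ker_mem_edges a b) (D.finrank_ker_inf_ker hab)
  have hcard : ({a, b, c, e} : Finset D.ι).card = 4 := by
    rw [Finset.card_insert_of_notMem, Finset.card_insert_of_notMem, Finset.card_pair hne] <;>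
      simp [*]
  have hsub : ({a, b, c, e} : Finset D.ι) ⊆ Finset.univ.filter fun i =>
      LinearMap.ker (D.g a) ⊓ LinearMap.ker (D.g b) ≤ LinearMap.ker (D.g i) := by
    intro i hi
    simp only [Finset.mem_insert, Finset.mem_singleton] at hi
    simp only [Finset.mem_filter, Finset.mem_univ, true_and]
    intro y hy
    simp only [Submodule.mem_inf, LinearMap.mem_ker] at hy ⊢
    rcases hi with rfl | rfl | rfl | rfl
    exacts [hy.1, hy.2, hc _ hy.1 hy.2, he _ hy.1 hy.2]
  have := Finset.card_le_card hsub
  rw [hcard] at this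
  unfold muRed at h
  omega

/-- A function vanishes on all lines of multiplicity `3` iff it vanishes on the lines cut out by
concurrent triples of hyperplanes. -/
theorem forall_edge_iff_forall_concurrent (D : Arrangement 3)
    (hmult : ∀ V ∈ D.edges, Module.finrank ℂ V = 1 → D.muRed V ≤ 3) (P : (Fin 3 → ℂ) → Prop) :
    (∀ V ∈ D.edges, Module.finrank ℂ V = 1 → D.muRed V = 3 → ∀ x : Fin 3 → ℂ, x ∈ V → P x) ↔
      ∀ a b c, D.Concurrent a b c → ∀ x, D.g a x = 0 → D.g b x = 0 → P x := by
  constructor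
  · rintro h a b c ⟨hab, hac, hbc, hc⟩ x hax hbx
    refine h _ (D.ker_inf_ker_mem_edges a b) (D.finrank_ker_inf_ker hab) ?_ x ⟨hax, hbx⟩
    refine le_antisymm (hmult _ (D.ker_inf_ker_mem_edges a b) (D.finrank_ker_inf_ker hab)) ?_
    have hcard : ({a, b, c} : Finset D.ι).card = 3 := by
      rw [Finset.card_insert_of_notMem, Finset.card_pair hbc]; simp [*]
    refine hcard.symm.le.trans (Finset.card_le_card ?_)
    intro i hi
    simp only [Finset.mem_insert, Finset.mem_singleton] at hi
    simp only [Finset.mem_filter, Finset.mem_univ, true_and]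
    intro y hy
    simp only [Submodule.mem_inf, LinearMap.mem_ker] at hy ⊢
    rcases hi with rfl | rfl | rfl
    exacts [hy.1, hy.2, hc _ hy.1 hy.2]
  · intro h V hV hV1 hV3 x hx
    obtain ⟨a, b, c, hab, hac, hbc, habc⟩ := Finset.card_eq_three.1 hV3
    have hmem : ∀ i ∈ ({a, b, c} : Finset D.ι), V ≤ LinearMap.ker (D.g i) := by
      intro i hi
      rw [← habc] at hi
      simpa using hi
    have hVa := hmem a (by simp)
    have hVb := hmem b (by simp)
    have hVc := hmem c (by simp)
    have hVeq : V = LinearMap.ker (D.g a) ⊓ LinearMap.ker (D.g b) :=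
      Submodule.eq_of_le_of_finrank_eq (le_inf hVa hVb)
        (by rw [hV1, D.finrank_ker_inf_ker hab])
    refine h a b c ⟨hab, hac, hbc, fun y ha hb => hVc ?_⟩ x (hVa hx) (hVb hx)
    rw [hVeq]
    exact ⟨ha, hb⟩

theorem exists_continuousLinearEquiv (φ : Fin 3 → ((Fin 3 → ℂ) →ₗ[ℂ] ℂ))
    (hφ : ∀ y, (∀ i, φ i y = 0) → y = 0) :
    ∃ L : (Fin 3 → ℂ) ≃L[ℂ] (Fin 3 → ℂ), ∀ y i, L y i = φ i y := by
  have hinj : Function.Injective (LinearMap.pi φ) := by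
    rw [injective_iff_map_eq_zero]
    intro y hy
    exact hφ y fun i => congrFun hy i
  exact ⟨(LinearEquiv.ofInjectiveEndo _ hinj).toContinuousLinearEquiv, fun y i => rfl⟩

theorem exists_coordinate (D : Arrangement 3) {a b : D.ι} (hab : a ≠ b) :
    ∃ i : Fin 3, ∀ y, D.g a y = 0 → D.g b y = 0 → y i = 0 → y = 0 := by
  obtain ⟨⟨w, hw⟩, hw0, hspan⟩ := finrank_eq_one_iff'.1 (D.finrank_ker_inf_ker hab)
  have hw0' : w ≠ 0 := fun h => hw0 (Subtype.ext h)
  obtain ⟨i, hi⟩ := Function.ne_iff.1 hw0'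
  refine ⟨i, fun y ha hb hyi => ?_⟩
  obtain ⟨t, ht⟩ := hspan ⟨y, ha, hb⟩
  have ht' : t • w = y := congrArg Subtype.val ht
  have : t * w i = 0 := by rw [← hyi, ← ht']; simp
  rcases mul_eq_zero.1 this with h | h
  · rw [← ht', h, zero_smul]
  · exact absurd h hi

/-- Two hyperplanes of the arrangement extend to a linear coordinate system. -/
theorem exists_coordinates (D : Arrangement 3) {a b : D.ι} (hab : a ≠ b) :
    ∃ (L : (Fin 3 → ℂ) ≃L[ℂ] (Fin 3 → ℂ)) (i : Fin 3),
      ∀ y, L y 0 = D.g a y ∧ L y 1 = D.g b y ∧ L y 2 = y i := by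
  obtain ⟨i, hi⟩ := D.exists_coordinate hab
  obtain ⟨L, hL⟩ := exists_continuousLinearEquiv ![D.g a, D.g b, LinearMap.proj i]
    (fun y hy => hi y (by simpa using hy 0) (by simpa using hy 1) (by simpa using hy 2))
  exact ⟨L, i, fun y => ⟨by simp [hL], by simp [hL], by simp [hL]⟩⟩

theorem exists_norm_le_of_not_concurrent (D : Arrangement 3) :
    ∃ K : ℝ, 1 ≤ K ∧ ∀ a b c, a ≠ b → a ≠ c → b ≠ c → ¬ D.Concurrent a b c → ∀ y,
      ‖y‖ ≤ K * (‖D.g a y‖ + ‖D.g b y‖ + ‖D.g c y‖) := by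
  have key : ∀ q : D.ι × D.ι × D.ι, ∃ K : ℝ, 0 ≤ K ∧ (q.1 ≠ q.2.1 → q.1 ≠ q.2.2 → q.2.1 ≠ q.2.2 →
      ¬ D.Concurrent q.1 q.2.1 q.2.2 → ∀ y,
      ‖y‖ ≤ K * (‖D.g q.1 y‖ + ‖D.g q.2.1 y‖ + ‖D.g q.2.2 y‖)) := by
    rintro ⟨a, b, c⟩
    by_cases h : a ≠ b ∧ a ≠ c ∧ b ≠ c ∧ ¬ D.Concurrent a b c
    swap
    · exact ⟨0, le_rfl, fun h1 h2 h3 h4 => absurd ⟨h1, h2, h3, h4⟩ h⟩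
    obtain ⟨hab, hac, hbc, hn⟩ := h
    obtain ⟨w, hwa, hwb, hwc⟩ : ∃ w, D.g a w = 0 ∧ D.g b w = 0 ∧ D.g c w ≠ 0 := by
      by_contra! hcon
      exact hn ⟨hab, hac, hbc, hcon⟩
    obtain ⟨L, hL⟩ := exists_continuousLinearEquiv ![D.g a, D.g b, D.g c] (by
      intro y hy
      have h0 : D.g a y = 0 := by simpa using hy 0
      have h1 : D.g b y = 0 := by simpa using hy 1
      have h2 : D.g c y = 0 := by simpa using hy 2
      obtain ⟨i, hi⟩ := D.exists_coordinate hab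
      have hwi : w i ≠ 0 := fun h => hwc (by rw [hi w hwa hwb h, map_zero])
      have h3 : y - (y i / w i) • w = 0 := hi _ (by simp [h0, hwa]) (by simp [h1, hwb])
        (by simp [hwi])
      have h4 : D.g c (y - (y i / w i) • w) = 0 := by rw [h3, map_zero]
      rw [map_sub, map_smul, h2, zero_sub, neg_eq_zero, smul_eq_mul, mul_eq_zero] at h4
      rcases h4 with h4 | h4
      · rwa [h4, zero_smul, sub_zero] at h3
      · exact absurd h4 hwc)
    refine ⟨‖(L.symm : (Fin 3 → ℂ) →L[ℂ] (Fin 3 → ℂ))‖, norm_nonneg _, fun _ _ _ _ y => ?_⟩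
    have h1 := (L.symm : (Fin 3 → ℂ) →L[ℂ] (Fin 3 → ℂ)).le_opNorm (L y)
    rw [ContinuousLinearEquiv.coe_coe, L.symm_apply_apply] at h1
    refine h1.trans ?_
    gcongr
    rw [pi_norm_le_iff_of_nonneg (by positivity)]
    intro i
    rw [hL]
    have ha := norm_nonneg (D.g a y)
    have hb := norm_nonneg (D.g b y)
    have hc := norm_nonneg (D.g c y)
    fin_cases i <;> simp <;> linarith
  choose K hK0 hK using key
  refine ⟨1 + ∑ q, K q, le_add_of_nonneg_right (Finset.sum_nonneg fun q _ => hK0 q), ?_⟩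
  intro a b c hab hac hbc hn y
  refine (hK (a, b, c) hab hac hbc hn y).trans ?_
  gcongr
  have := Finset.single_le_sum (fun q _ => hK0 q) (Finset.mem_univ (a, b, c))
  linarith

theorem exists_pair_norm_le_prod (D : Arrangement 3) (hd : 3 < Fintype.card D.ι)
    (hmult : ∀ V ∈ D.edges, Module.finrank ℂ V = 1 → D.muRed V ≤ 3) :
    ∃ C : ℝ, 0 < C ∧ ∀ (y : Fin 3 → ℂ) (h : ℝ), 0 ≤ h → h ≤ 1 →
      (∀ a b c, D.Concurrent a b c → h * ‖y‖ ≤ ‖D.g a y‖ + ‖D.g b y‖ + ‖D.g c y‖) →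
      ∃ a b, a ≠ b ∧
        h * ‖y‖ ^ (Fintype.card D.ι - 2) * (‖D.g a y‖ * ‖D.g b y‖) ≤ C * ∏ i, ‖D.g i y‖ := by
  obtain ⟨K, hK1, hK⟩ := D.exists_norm_le_of_not_concurrent
  refine ⟨(3 * K) ^ (Fintype.card D.ι - 2), by positivity, ?_⟩
  intro y h h0 h1 hconc
  set N : D.ι → ℝ := fun i => ‖D.g i y‖ with hN
  have hN0 : ∀ i, 0 ≤ N i := fun i => norm_nonneg _
  have hcard : (Finset.univ : Finset D.ι).card = Fintype.card D.ι := rfl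
  obtain ⟨a, -, ha⟩ := Finset.univ.exists_min_image N (Finset.card_pos.1 (by omega))
  have hca := Finset.card_erase_of_mem (Finset.mem_univ a)
  obtain ⟨b, hbm, hb⟩ := (Finset.univ.erase a).exists_min_image N (Finset.card_pos.1 (by omega))
  have hcb := Finset.card_erase_of_mem hbm
  obtain ⟨c, hcm, hc⟩ := ((Finset.univ.erase a).erase b).exists_min_image N
    (Finset.card_pos.1 (by omega))
  have hcc := Finset.card_erase_of_mem hcm
  have hab : a ≠ b := (Finset.ne_of_mem_erase hbm).symm
  have hbc : b ≠ c := (Finset.ne_of_mem_erase hcm).symm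
  have hac : a ≠ c := (Finset.ne_of_mem_erase (Finset.mem_of_mem_erase hcm)).symm
  have hle1 : N a ≤ N b := ha _ (Finset.mem_univ _)
  have hle2 : N b ≤ N c := hb _ (Finset.mem_of_mem_erase hcm)
  refine ⟨a, b, hab, ?_⟩
  have hothers : ∀ e ∈ ((Finset.univ.erase a).erase b).erase c, ‖y‖ ≤ 3 * K * N e := by
    intro e he
    have hec : e ≠ c := Finset.ne_of_mem_erase he
    have he' := Finset.mem_of_mem_erase he
    have heb : e ≠ b := Finset.ne_of_mem_erase he'
    have hea : e ≠ a := Finset.ne_of_mem_erase (Finset.mem_of_mem_erase he')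
    have hce : N c ≤ N e := hc _ he'
    have hsum : ∀ z, N z ≤ N e → K * (N a + N b + N z) ≤ 3 * K * N e := by
      intro z hz
      nlinarith
    by_cases hcon : D.Concurrent a b e
    · have hcon' : ¬ D.Concurrent a b c := fun hcon' => hec (D.eq_of_concurrent hmult hcon hcon')
      exact (hK a b c hab hac hbc hcon' y).trans (hsum c hce)
    · exact (hK a b e hab hea.symm heb.symm hcon y).trans (hsum e le_rfl)
  have hcbound : h * ‖y‖ ≤ 3 * K * N c := by
    by_cases hcon : D.Concurrent a b c
    · have := hconc a b c hcon
      change _ ≤ N a + N b + N c at this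
      nlinarith [hN0 c]
    · have h3 := hK a b c hab hac hbc hcon y
      change _ ≤ K * (N a + N b + N c) at h3
      have h4 : h * ‖y‖ ≤ ‖y‖ := mul_le_of_le_one_left (norm_nonneg _) h1
      nlinarith
  have hprod : ∏ i, N i = N a * (N b * (N c *
      ∏ e ∈ ((Finset.univ.erase a).erase b).erase c, N e)) := by
    rw [Finset.mul_prod_erase _ _ hcm, Finset.mul_prod_erase _ _ hbm,
      Finset.mul_prod_erase _ _ (Finset.mem_univ a)]
  have hp2 := Finset.prod_le_prod (s := ((Finset.univ.erase a).erase b).erase c)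
    (fun _ _ => norm_nonneg y) hothers
  rw [Finset.prod_const, Finset.prod_mul_distrib, Finset.prod_const, hcc, hcb, hca, hcard] at hp2
  set P := ∏ e ∈ ((Finset.univ.erase a).erase b).erase c, N e
  have hP : 0 ≤ P := Finset.prod_nonneg fun i _ => hN0 i
  have hd2 : Fintype.card D.ι - 2 = (Fintype.card D.ι - 1 - 1 - 1) + 1 := by omega
  set k := Fintype.card D.ι - 1 - 1 - 1
  have hmul := mul_le_mul hp2 hcbound (by positivity)
    (mul_nonneg (pow_nonneg (by linarith) _) hP)
  change _ ≤ _ * ∏ i, N i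
  rw [hprod, hd2]
  calc h * ‖y‖ ^ (k + 1) * (N a * N b) = (‖y‖ ^ k * (h * ‖y‖)) * (N a * N b) := by ring
    _ ≤ ((3 * K) ^ k * P * (3 * K * N c)) * (N a * N b) := by
        have := mul_nonneg (hN0 a) (hN0 b)
        gcongr
    _ = _ := by ring

end Arrangement

theorem sq_mul_rpow_neg_le_of_mul_le {n A B Z F h C C₁ K R β p s e : ℝ} {k m : ℕ}
    (hn : 0 < n) (hA : 0 < A) (hB : 0 < B) (hZ : 0 < Z) (hF : 0 < F)
    (h0 : 0 ≤ h) (h1 : h ≤ 1) (hC₁ : 0 < C₁) (hK : 0 < K) (hβ0 : 0 < β) (hβ1 : β < 1)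
    (hs : 0 ≤ s) (hps : p = s + 2 * β) (he : 0 ≤ e) (hnR : n ≤ R)
    (hexp : 2 * k - 2 * β * m = e - s - s - p)
    (hle : h * n ^ m * (A * B) ≤ C₁ * F) (hAn : A ≤ K * n) (hBn : B ≤ K * n) (hZn : Z ≤ n) :
    (C * n ^ k * h) ^ 2 * F ^ (-2 * β) ≤
      C ^ 2 * C₁ ^ (2 * β) * R ^ e * K ^ s * K ^ s * (A ^ (-p) * B ^ (-p) * Z ^ (-p)) := by
  have hp : 0 < p := by linarith
  have e1 : h ^ 2 ≤ h ^ (2 * β) := by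
    rw [← Real.rpow_natCast]
    exact Real.rpow_le_rpow_of_exponent_ge' h0 h1 (by linarith) (by push_cast; linarith)
  have e2 : h ^ (2 * β) * F ^ (-2 * β) ≤
      C₁ ^ (2 * β) * (n ^ (-(2 * β * m)) * (A ^ (-(2 * β)) * B ^ (-(2 * β)))) := by
    have := Real.rpow_le_rpow (by positivity) hle (by linarith : 0 ≤ 2 * β)
    rw [Real.mul_rpow (by positivity) (by positivity), Real.mul_rpow h0 (by positivity),
      Real.mul_rpow hA.le hB.le, Real.mul_rpow hC₁.le hF.le, ← Real.rpow_natCast,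
      ← Real.rpow_mul hn.le] at this
    rw [neg_mul, Real.rpow_neg hF.le, Real.rpow_neg hn.le, Real.rpow_neg hA.le,
      Real.rpow_neg hB.le, mul_comm (2 * β) (m : ℝ), ← div_eq_mul_inv, div_le_iff₀ (by positivity)]
    calc h ^ (2 * β) = (h ^ (2 * β) * n ^ (m * (2 * β)) * (A ^ (2 * β) * B ^ (2 * β))) *
          ((n ^ (m * (2 * β)))⁻¹ * ((A ^ (2 * β))⁻¹ * (B ^ (2 * β))⁻¹)) := by field_simp
      _ ≤ (C₁ ^ (2 * β) * F ^ (2 * β)) *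
          ((n ^ (m * (2 * β)))⁻¹ * ((A ^ (2 * β))⁻¹ * (B ^ (2 * β))⁻¹)) := by gcongr
      _ = _ := by ring
  have small : ∀ {T : ℝ}, 0 < T → T ≤ K * n → n ^ (-s) ≤ K ^ s * T ^ (-s) := by
    intro T hT hTn
    rw [Real.rpow_neg hn.le, Real.rpow_neg hT.le, ← div_eq_mul_inv, le_div_iff₀ (by positivity),
      inv_mul_le_iff₀ (by positivity), ← Real.mul_rpow hn.le hK.le]
    exact Real.rpow_le_rpow hT.le (by linarith) hs
  have e3 : n ^ (-p) ≤ Z ^ (-p) := Real.rpow_le_rpow_of_nonpos hZ hZn (by linarith)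
  have e4 : n ^ e ≤ R ^ e := Real.rpow_le_rpow hn.le hnR he
  have e5 : (n ^ k) ^ 2 * n ^ (-(2 * β * m)) = n ^ e * n ^ (-s) * n ^ (-s) * n ^ (-p) := by
    rw [← pow_mul, ← Real.rpow_natCast, ← Real.rpow_add hn, ← Real.rpow_add hn,
      ← Real.rpow_add hn, ← Real.rpow_add hn]
    congr 1
    push_cast
    linarith
  have e6 : ∀ {T : ℝ}, 0 < T → T ^ (-p) = T ^ (-s) * T ^ (-(2 * β)) := by
    intro T hT
    rw [← Real.rpow_add hT]
    congr 1
    linarith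
  calc (C * n ^ k * h) ^ 2 * F ^ (-2 * β) = C ^ 2 * (n ^ k) ^ 2 * (h ^ 2 * F ^ (-2 * β)) := by ring
    _ ≤ C ^ 2 * (n ^ k) ^ 2 * (h ^ (2 * β) * F ^ (-2 * β)) := by gcongr
    _ ≤ C ^ 2 * (n ^ k) ^ 2 *
        (C₁ ^ (2 * β) * (n ^ (-(2 * β * m)) * (A ^ (-(2 * β)) * B ^ (-(2 * β))))) := by gcongr
    _ = C ^ 2 * C₁ ^ (2 * β) * (A ^ (-(2 * β)) * B ^ (-(2 * β))) *
        ((n ^ k) ^ 2 * n ^ (-(2 * β * m))) := by ring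
    _ = C ^ 2 * C₁ ^ (2 * β) * (A ^ (-(2 * β)) * B ^ (-(2 * β))) *
        (n ^ e * n ^ (-s) * n ^ (-s) * n ^ (-p)) := by rw [e5]
    _ ≤ C ^ 2 * C₁ ^ (2 * β) * (A ^ (-(2 * β)) * B ^ (-(2 * β))) *
        (R ^ e * (K ^ s * A ^ (-s)) * (K ^ s * B ^ (-s)) * Z ^ (-p)) := by
        have hR : 0 < R := hn.trans_le hnR
        have := small hA hAn
        have := small hB hBn
        gcongr
    _ = _ := by rw [e6 hA, e6 hB]; ring

theorem LinearMap.ae_apply_ne_zero {φ : (Fin 3 → ℂ) →ₗ[ℂ] ℂ} (hφ : φ ≠ 0) :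
    ∀ᵐ y : Fin 3 → ℂ, φ y ≠ 0 := by
  have h : (LinearMap.ker φ).restrictScalars ℝ ≠ ⊤ := by
    intro h
    refine hφ (LinearMap.ext fun y => ?_)
    have : y ∈ (LinearMap.ker φ).restrictScalars ℝ := h ▸ Submodule.mem_top
    simpa using this
  have := Measure.addHaar_submodule (volume : Measure (Fin 3 → ℂ)) _ h
  rw [ae_iff]
  convert this using 2
  ext y
  simp

namespace Arrangement

theorem Reduced.f_apply {D : Arrangement 3} (hred : D.Reduced) (y : Fin 3 → ℂ) :
    D.f y = ∏ i, D.g i y := by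
  simp [f, hred _]

theorem Reduced.degree_eq {D : Arrangement 3} (hred : D.Reduced) :
    D.degree = Fintype.card D.ι := by
  simp [degree, hred _]

theorem continuous_f (D : Arrangement 3) : Continuous D.f :=
  continuous_finsetProd _ fun i _ => (LinearMap.continuous_of_finiteDimensional (D.g i)).pow _

theorem ae_f_ne_zero (D : Arrangement 3) : ∀ᵐ y, D.f y ≠ 0 := by
  have : ∀ᵐ y, ∀ i, D.g i y ≠ 0 := ae_all_iff.2 fun i => LinearMap.ae_apply_ne_zero (D.g_ne i)
  filter_upwards [this] with y hy
  exact Finset.prod_ne_zero_iff.2 fun i _ => pow_ne_zero _ (hy i)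

theorem integrableOn_of_norm_le {D : Arrangement 3} (hred : D.Reduced) (hd : 3 < D.degree)
    (hmult : ∀ V ∈ D.edges, Module.finrank ℂ V = 1 → D.muRed V ≤ 3) {β : ℝ} (hβ0 : 0 < β)
    (hβ1 : β < 1) {k : ℕ} (hk : D.degree * β < k + 3) {g : (Fin 3 → ℂ) → ℂ} {x : Fin 3 → ℂ}
    {r C : ℝ} (hC : 0 < C) (hg : ContinuousOn g (Metric.ball x r))
    (h1 : ∀ y ∈ Metric.ball x r, ‖g y‖ ≤ C * ‖y‖ ^ k)
    (h2 : ∀ y ∈ Metric.ball x r, ∀ a b c, D.Concurrent a b c →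
      ‖g y‖ * ‖y‖ ≤ C * ‖y‖ ^ k * (‖D.g a y‖ + ‖D.g b y‖ + ‖D.g c y‖)) :
    IntegrableOn (fun y => ‖g y‖ ^ 2 * ‖D.f y‖ ^ (-2 * β)) (Metric.ball x r) := by
  rw [hred.degree_eq] at hd hk
  obtain ⟨C₁, hC₁, hP⟩ := D.exists_pair_norm_le_prod hd hmult
  obtain ⟨K, hK, hKn⟩ : ∃ K : ℝ, 0 < K ∧ ∀ i y, ‖D.g i y‖ ≤ K * ‖y‖ := by
    refine ⟨1 + ∑ i, ‖(LinearMap.toContinuousLinearMap (D.g i))‖, by positivity, fun i y => ?_⟩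
    refine ((LinearMap.toContinuousLinearMap (D.g i)).le_opNorm y).trans ?_
    gcongr
    have := Finset.single_le_sum (f := fun i => ‖(LinearMap.toContinuousLinearMap (D.g i))‖)
      (fun i _ => norm_nonneg _) (Finset.mem_univ i)
    exact this.trans (le_add_of_nonneg_left zero_le_one)
  have hcoord : ∀ q : D.ι × D.ι, ∃ (L : (Fin 3 → ℂ) ≃L[ℂ] (Fin 3 → ℂ)) (i : Fin 3), q.1 ≠ q.2 →
      ∀ y, L y 0 = D.g q.1 y ∧ L y 1 = D.g q.2 y ∧ L y 2 = y i := by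
    intro q
    by_cases hq : q.1 = q.2
    · exact ⟨ContinuousLinearEquiv.refl _ _, 0, fun h => absurd hq h⟩
    · obtain ⟨L, i, h⟩ := D.exists_coordinates hq
      exact ⟨L, i, fun _ => h⟩
  choose L ind hL using hcoord
  set δ : ℝ := min ((2 * k + 6 - 2 * (Fintype.card D.ι * β)) / 3) (2 - 2 * β) with hδ
  have hδ0 : 0 < δ := lt_min (by linarith) (by linarith)
  have hδ1 : 3 * δ ≤ 2 * k + 6 - 2 * (Fintype.card D.ι * β) := by
    have := min_le_left ((2 * k + 6 - 2 * (Fintype.card D.ι * β)) / 3) (2 - 2 * β)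
    linarith
  have hδ2 : δ ≤ 2 - 2 * β := min_le_right _ _
  set R : ℝ := ‖x‖ + r
  set e : ℝ := 2 * k + 6 - 2 * (Fintype.card D.ι * β) - 3 * δ with he
  set s : ℝ := 2 - δ - 2 * β with hs
  set M : ℝ := C ^ 2 * C₁ ^ (2 * β) * R ^ e * K ^ s * K ^ s
  have hball : Metric.ball x r ⊆ Metric.ball 0 R := by
    intro y hy
    rw [mem_ball_iff_norm] at hy
    rw [mem_ball_zero_iff]
    calc ‖y‖ = ‖x + (y - x)‖ := by congr 1; abel
      _ ≤ ‖x‖ + ‖y - x‖ := norm_add_le _ _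
      _ < R := by simp only [R]; linarith
  refine Integrable.mono' (g := fun y => ∑ q : D.ι × D.ι, M * ∏ i, ‖L q y i‖ ^ (-(2 - δ))) ?_ ?_ ?_
  · refine integrable_finsetSum _ fun q _ => Integrable.const_mul ?_ _
    exact (integrableOn_ball_prod_norm_apply_rpow_neg (L q) (by linarith) R).mono_set hball
  · refine AEStronglyMeasurable.mul ?_ ?_
    · exact ((hg.norm).pow 2).aestronglyMeasurable Metric.isOpen_ball.measurableSet
    · exact ((D.continuous_f.norm.measurable).pow_const _).aestronglyMeasurable
  · have hcoords : ∀ᵐ y : Fin 3 → ℂ, ∀ i, y i ≠ 0 := ae_all_iff.2 fun i =>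
      LinearMap.ae_apply_ne_zero (φ := LinearMap.proj i) (by
        intro h
        simpa using LinearMap.congr_fun h (Pi.single i 1))
    filter_upwards [ae_restrict_of_ae hcoords, ae_restrict_of_ae D.ae_f_ne_zero,
      ae_restrict_mem Metric.isOpen_ball.measurableSet] with y hyc hyf hyB
    have hn : 0 < ‖y‖ := norm_pos_iff.2 fun h => hyc 0 (by simp [h])
    have hden : 0 < C * ‖y‖ ^ k := by positivity
    rw [Real.norm_of_nonneg (by positivity)]
    obtain ⟨a, b, hab, hle⟩ := hP y (‖g y‖ / (C * ‖y‖ ^ k)) (by positivity)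
      ((div_le_one hden).2 (h1 y hyB)) (fun a b c habc => by
        rw [div_mul_eq_mul_div, div_le_iff₀ hden, mul_comm (_ + _)]
        exact h2 y hyB a b c habc)
    have hgi : ∀ i, 0 < ‖D.g i y‖ := by
      intro i
      rw [hred.f_apply, Finset.prod_ne_zero_iff] at hyf
      exact norm_pos_iff.2 (hyf i (Finset.mem_univ i))
    have hnR : ‖y‖ ≤ R := (mem_ball_zero_iff.1 (hball hyB)).le
    obtain ⟨hL0, hL1, hL2⟩ := hL (a, b) hab y
    have hcard : ((Fintype.card D.ι - 2 : ℕ) : ℝ) = Fintype.card D.ι - 2 := by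
      rw [Nat.cast_sub (by omega)]
      norm_num
    have key := sq_mul_rpow_neg_le_of_mul_le (C := C) (k := k) (e := e) (s := s) (p := 2 - δ) hn
      (hgi a) (hgi b)
      (norm_pos_iff.2 (hyc (ind (a, b)))) (norm_pos_iff.2 hyf) (by positivity)
      ((div_le_one hden).2 (h1 y hyB)) hC₁ hK hβ0 hβ1 (by linarith) (by linarith) (by linarith) hnR
      (by rw [hcard]; simp only [he, hs]; ring) (by rwa [hred.f_apply, norm_prod]) (hKn a y)
      (hKn b y) (norm_le_pi_norm y _)
    rw [mul_div_cancel₀ _ hden.ne'] at key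
    have hterm : ∀ q : D.ι × D.ι, 0 ≤ M * ∏ i, ‖L q y i‖ ^ (-(2 - δ)) := by
      intro q
      have : 0 ≤ R := hn.le.trans hnR
      positivity
    refine le_trans ?_ (Finset.single_le_sum (fun q _ => hterm q) (Finset.mem_univ (a, b)))
    rwa [Fin.prod_univ_three, hL0, hL1, hL2]


theorem Concurrent.exists_combination {D : Arrangement 3} {a b c : D.ι} (h : D.Concurrent a b c) :
    ∃ s t : ℂ, ∀ y, D.g c y = D.g a y * s + D.g b y * t := by
  obtain ⟨hab, -, -, hc⟩ := h
  obtain ⟨u, v, h1, h2, h3, h4⟩ := D.exists_dual_pair hab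
  refine ⟨D.g c u, D.g c v, fun y => ?_⟩
  have := hc (y - D.g a y • u - D.g b y • v) (by simp [h1, h3]) (by simp [h2, h4])
  simp only [map_sub, map_smul, smul_eq_mul] at this
  linear_combination this

theorem exists_coordinates_prod (D : Arrangement 3) {a b : D.ι} (hab : a ≠ b) :
    ∃ L : (Fin 3 → ℂ) ≃L[ℂ] (ℂ × ℂ) × ℂ, ∀ y, (L y).1 = (D.g a y, D.g b y) := by
  obtain ⟨L, i, hL⟩ := D.exists_coordinates hab
  let E : (Fin 3 → ℂ) ≃ₗ[ℂ] (ℂ × ℂ) × ℂ :=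
    { toFun := fun y => ((y 0, y 1), y 2)
      invFun := fun q => ![q.1.1, q.1.2, q.2]
      map_add' := fun _ _ => rfl
      map_smul' := fun _ _ => rfl
      left_inv := fun y => by ext i; fin_cases i <;> rfl
      right_inv := fun q => rfl }
  refine ⟨L.trans E.toContinuousLinearEquiv, fun y => ?_⟩
  change (L y 0, L y 1) = _
  rw [(hL y).1, (hL y).2.1]

theorem Concurrent.eq_zero_of_integrableOn {D : Arrangement 3} (hred : D.Reduced) {a b c : D.ι}
    (h : D.Concurrent a b c) {p : Fin 3 → ℂ} (hpa : D.g a p = 0) (hpb : D.g b p = 0)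
    {g : (Fin 3 → ℂ) → ℂ} (hg : ContinuousAt g p) {β : ℝ} (hβ : 2 / 3 ≤ β)
    {W : Set (Fin 3 → ℂ)} (hW : W ∈ nhds p)
    (hint : IntegrableOn (fun y => ‖g y‖ ^ 2 * ‖D.f y‖ ^ (-2 * β)) W) : g p = 0 := by
  by_contra hgp
  obtain ⟨L, hL⟩ := D.exists_coordinates_prod h.1
  obtain ⟨s, t, hst⟩ := h.exists_combination
  obtain ⟨hab, hac, hbc, -⟩ := h
  have hLp : (L p).1 = 0 := by rw [hL, hpa, hpb]; rfl
  have hcont : ∀ i, Continuous (D.g i) := fun i => LinearMap.continuous_of_finiteDimensional _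
  set R : (Fin 3 → ℂ) → ℂ := fun y =>
    ∏ i ∈ ((Finset.univ.erase a).erase b).erase c, D.g i y with hR
  have hRc : Continuous R := continuous_finsetProd _ fun i _ => hcont i
  have hf : ∀ y, D.f y = D.g a y * (D.g b y * (D.g c y * R y)) := by
    intro y
    rw [hred.f_apply, hR, Finset.mul_prod_erase _ (fun i => D.g i y) (by simp [hac.symm, hbc.symm]),
      Finset.mul_prod_erase _ (fun i => D.g i y) (by simp [hab.symm]),
      Finset.mul_prod_erase _ (fun i => D.g i y) (by simp)]
  set N : (Fin 3 → ℂ) → ℝ := fun y => ‖(L y).1‖ with hN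
  have hNc : Continuous N := continuous_norm.comp (continuous_fst.comp L.continuous)
  have hNa : ∀ y, ‖D.g a y‖ ≤ N y := fun y => by rw [hN]; simp [hL]
  have hNb : ∀ y, ‖D.g b y‖ ≤ N y := fun y => by rw [hN]; simp [hL]
  have hNg : ∀ y, ‖D.g c y‖ ≤ N y * (‖s‖ + ‖t‖) := by
    intro y
    rw [hst]
    calc ‖D.g a y * s + D.g b y * t‖ ≤ ‖D.g a y‖ * ‖s‖ + ‖D.g b y‖ * ‖t‖ := by
          rw [← norm_mul, ← norm_mul]; exact norm_add_le _ _
      _ ≤ N y * ‖s‖ + N y * ‖t‖ := by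
          gcongr
          · exact hNa y
          · exact hNb y
      _ = _ := by ring
  set M : ℝ := (‖s‖ + ‖t‖ + 1) * (‖R p‖ + 1) with hM
  have hM0 : 0 < M := by positivity
  have ev1 : ∀ᶠ y in nhds p, ‖R y‖ < ‖R p‖ + 1 :=
    (hRc.norm.continuousAt).eventually_lt_const (by simp)
  have ev2 : ∀ᶠ y in nhds p, N y < 1 :=
    hNc.continuousAt.eventually_lt_const (by simp [hN, hLp])
  have ev3 : ∀ᶠ y in nhds p, ‖g p‖ / 2 < ‖g y‖ :=
    hg.norm.eventually_const_lt (by have := norm_pos_iff.2 hgp; linarith)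
  obtain ⟨V, hV, hVsub⟩ := (ev1.and (ev2.and ev3)).exists_mem
  refine not_integrableOn_of_norm_fst_pow_four_inv_le L hLp (Filter.inter_mem hW hV)
    (c := (‖g p‖ / 2) ^ 2 * M ^ (-2 * β))
    (mul_pos (pow_pos (half_pos (norm_pos_iff.2 hgp)) 2) (Real.rpow_pos_of_pos hM0 _)) ?_
    (hint.mono_set Set.inter_subset_left)
  filter_upwards [D.ae_f_ne_zero] with y hy hyW
  obtain ⟨h1, h2, h3⟩ := hVsub y hyW.2
  have hN0 : 0 < N y := by
    refine lt_of_lt_of_le (norm_pos_iff.2 ?_) (hNa y)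
    intro h0
    exact hy (by rw [hf, h0, zero_mul])
  have hle : ‖D.f y‖ ≤ M * N y ^ 3 := by
    rw [hf, norm_mul, norm_mul, norm_mul]
    calc _ ≤ N y * (N y * ((N y * (‖s‖ + ‖t‖)) * (‖R p‖ + 1))) := by
          gcongr
          · exact hNa y
          · exact hNb y
          · exact hNg y
      _ ≤ N y * (N y * ((N y * (‖s‖ + ‖t‖ + 1)) * (‖R p‖ + 1))) := by
          gcongr N y * (N y * (N y * ?_ * _))
          linarith
      _ = _ := by rw [hM]; ring
  have hpow : M ^ (-2 * β) * (N y ^ 4)⁻¹ ≤ ‖D.f y‖ ^ (-2 * β) := by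
    have e1 : (M * N y ^ 3) ^ (-2 * β) ≤ ‖D.f y‖ ^ (-2 * β) :=
      Real.rpow_le_rpow_of_nonpos (norm_pos_iff.2 hy) hle (by linarith)
    refine le_trans ?_ e1
    rw [Real.mul_rpow hM0.le (by positivity), ← Real.rpow_natCast (N y) 3,
      ← Real.rpow_natCast (N y) 4, ← Real.rpow_mul hN0.le, ← Real.rpow_neg hN0.le]
    gcongr ?_ * ?_
    refine Real.rpow_le_rpow_of_exponent_ge hN0 h2.le ?_
    push_cast
    linarith
  calc (‖g p‖ / 2) ^ 2 * M ^ (-2 * β) * (N y ^ 4)⁻¹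
      = (‖g p‖ / 2) ^ 2 * (M ^ (-2 * β) * (N y ^ 4)⁻¹) := by ring
    _ ≤ _ := by gcongr


theorem exists_norm_mul_le_of_eq_zero_on_lines (D : Arrangement 3) :
    ∃ κ : ℝ, 0 < κ ∧ ∀ a b, a ≠ b → ∀ (g : (Fin 3 → ℂ) → ℂ) (y : Fin 3 → ℂ) (ρ B : ℝ), 0 < ρ →
      DifferentiableOn ℂ g (Metric.ball y (2 * ρ)) →
      (∀ z ∈ Metric.ball y (2 * ρ), ‖g z‖ ≤ B) →
      (∀ z ∈ Metric.ball y (2 * ρ), D.g a z = 0 → D.g b z = 0 → g z = 0) →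
      ‖g y‖ * ρ ≤ B * (κ * (‖D.g a y‖ + ‖D.g b y‖)) := by
  have hproj : ∀ q : D.ι × D.ι, ∃ κ : ℝ, 0 < κ ∧ (q.1 ≠ q.2 → ∀ y, ∃ z,
      D.g q.1 z = 0 ∧ D.g q.2 z = 0 ∧ ‖y - z‖ ≤ κ * (‖D.g q.1 y‖ + ‖D.g q.2 y‖)) := by
    intro q
    by_cases hq : q.1 = q.2
    · exact ⟨1, one_pos, fun h => absurd hq h⟩
    obtain ⟨u, v, h1, h2, h3, h4⟩ := D.exists_dual_pair hq
    refine ⟨‖u‖ + ‖v‖ + 1, by positivity, fun _ y =>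
      ⟨y - (D.g q.1 y • u + D.g q.2 y • v), by simp [h1, h3], by simp [h2, h4], ?_⟩⟩
    rw [sub_sub_cancel]
    refine (norm_add_le _ _).trans ?_
    rw [norm_smul, norm_smul]
    nlinarith [norm_nonneg u, norm_nonneg v, norm_nonneg (D.g q.1 y), norm_nonneg (D.g q.2 y),
      mul_nonneg (norm_nonneg v) (norm_nonneg (D.g q.1 y)),
      mul_nonneg (norm_nonneg u) (norm_nonneg (D.g q.2 y))]
  choose κ hκ hz using hproj
  have hne := D.nonemptyι
  refine ⟨∑ q, κ q, Finset.sum_pos (fun q _ => hκ q) Finset.univ_nonempty, ?_⟩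
  intro a b hab g y ρ B hρ hg hB hzero
  obtain ⟨z, hza, hzb, hyz⟩ := hz (a, b) hab y
  have hκle : κ (a, b) ≤ ∑ q, κ q :=
    Finset.single_le_sum (fun q _ => (hκ q).le) (Finset.mem_univ (a, b))
  have hyB : ‖g y‖ ≤ B := hB y (Metric.mem_ball_self (by positivity))
  have hB0 : 0 ≤ B := (norm_nonneg _).trans hyB
  have key : ‖g y‖ * ρ ≤ B * ‖y - z‖ := by
    rcases lt_or_ge ‖y - z‖ ρ with hlt | hge
    · have hzball : z ∈ Metric.ball y (2 * ρ) := by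
        rw [Metric.mem_ball, dist_comm, dist_eq_norm]
        linarith
      have hsub : Metric.ball z ρ ⊆ Metric.ball y (2 * ρ) := by
        refine Metric.ball_subset_ball' ?_
        rw [dist_comm, dist_eq_norm]
        linarith
      have hgz := hzero z hzball hza hzb
      have := Complex.dist_le_div_mul_dist_of_mapsTo_ball (hg.mono hsub) (R₂ := B)
        (fun w hw => by
          rw [hgz, mem_closedBall_zero_iff]
          exact hB w (hsub hw)) (z := y) (by rwa [Metric.mem_ball, dist_eq_norm])
      rw [hgz, dist_zero_right, dist_eq_norm, div_mul_eq_mul_div, le_div_iff₀ hρ] at this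
      exact this
    · gcongr
  refine key.trans (mul_le_mul_of_nonneg_left (hyz.trans ?_) hB0)
  gcongr

theorem exists_norm_mul_norm_le_of_eq_zero_on_lines (D : Arrangement 3) {g : (Fin 3 → ℂ) → ℂ}
    {r C : ℝ} {k : ℕ} (hC : 0 < C) (hg : DifferentiableOn ℂ g (Metric.ball 0 r))
    (hbound : ∀ y ∈ Metric.ball 0 r, ‖g y‖ ≤ C * ‖y‖ ^ k)
    (hzero : ∀ a b c, D.Concurrent a b c → ∀ y ∈ Metric.ball 0 r,
      D.g a y = 0 → D.g b y = 0 → g y = 0) :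
    ∃ C', 0 < C' ∧ ∀ y ∈ Metric.ball (0 : Fin 3 → ℂ) (r / 2), ∀ a b c, D.Concurrent a b c →
      ‖g y‖ * ‖y‖ ≤ C' * ‖y‖ ^ k * (‖D.g a y‖ + ‖D.g b y‖ + ‖D.g c y‖) := by
  obtain ⟨κ, hκ, h⟩ := D.exists_norm_mul_le_of_eq_zero_on_lines
  refine ⟨2 * (C * 2 ^ k * κ), by positivity, fun y hy a b c habc => ?_⟩
  rw [mem_ball_zero_iff] at hy
  rcases eq_or_ne y 0 with rfl | hy0
  · simp
  have hn := norm_pos_iff.2 hy0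
  have hsub : ∀ z ∈ Metric.ball y (2 * (‖y‖ / 2)), ‖z‖ ≤ 2 * ‖y‖ := by
    intro z hz
    rw [Metric.mem_ball, dist_eq_norm] at hz
    have := norm_sub_norm_le z y
    linarith
  have hsub' : Metric.ball y (2 * (‖y‖ / 2)) ⊆ Metric.ball 0 r := fun z hz => by
    rw [mem_ball_zero_iff]
    linarith [hsub z hz]
  have := h a b habc.1 g y (‖y‖ / 2) (C * (2 * ‖y‖) ^ k) (by positivity) (hg.mono hsub')
    (fun z hz => (hbound z (hsub' hz)).trans (by gcongr; exact hsub z hz))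
    (fun z hz => hzero a b c habc z (hsub' hz))
  calc ‖g y‖ * ‖y‖ = 2 * (‖g y‖ * (‖y‖ / 2)) := by ring
    _ ≤ 2 * (C * (2 * ‖y‖) ^ k * (κ * (‖D.g a y‖ + ‖D.g b y‖ + ‖D.g c y‖))) := by
        refine mul_le_mul_of_nonneg_left (this.trans ?_) zero_le_two
        gcongr _ * (_ * ?_)
        exact le_add_of_nonneg_right (norm_nonneg _)
    _ = _ := by rw [mul_pow]; ring

theorem exists_integrableOn_of_norm_le {D : Arrangement 3} (hred : D.Reduced) (hd : 3 < D.degree)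
    (hmult : ∀ V ∈ D.edges, Module.finrank ℂ V = 1 → D.muRed V ≤ 3) {β : ℝ} (hβ0 : 0 < β)
    (hβ1 : β < 1) {k : ℕ} (hk : D.degree * β < k + 3) {g : (Fin 3 → ℂ) → ℂ} {r C : ℝ}
    (hr : 0 < r) (hC : 0 < C) (hg : DifferentiableOn ℂ g (Metric.ball 0 r))
    (hbound : ∀ y ∈ Metric.ball 0 r, ‖g y‖ ≤ C * ‖y‖ ^ k)
    (hzero : ∀ a b c, D.Concurrent a b c → ∀ y ∈ Metric.ball 0 r,
      D.g a y = 0 → D.g b y = 0 → g y = 0) :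
    ∃ W ∈ nhds (0 : Fin 3 → ℂ), IntegrableOn (fun y => ‖g y‖ ^ 2 * ‖D.f y‖ ^ (-2 * β)) W := by
  obtain ⟨C', hC', h⟩ := D.exists_norm_mul_norm_le_of_eq_zero_on_lines hC hg hbound hzero
  have hsub : Metric.ball (0 : Fin 3 → ℂ) (r / 2) ⊆ Metric.ball 0 r :=
    Metric.ball_subset_ball (by linarith)
  refine ⟨_, Metric.ball_mem_nhds 0 (half_pos hr), integrableOn_of_norm_le hred hd hmult hβ0 hβ1 hk
    (C := C + C') (by positivity) (hg.continuousOn.mono hsub) (fun y hy => ?_)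
    (fun y hy a b c habc => ?_)⟩
  · refine (hbound y (hsub hy)).trans ?_
    gcongr
    linarith
  · refine (h y hy a b c habc).trans ?_
    gcongr
    linarith

theorem exists_integrableOn_of_ne_zero {D : Arrangement 3} (hred : D.Reduced) (hd : 3 < D.degree)
    (hmult : ∀ V ∈ D.edges, Module.finrank ℂ V = 1 → D.muRed V ≤ 3) {β : ℝ} (hβ0 : 0 < β)
    (hβ1 : β < 1) {g : (Fin 3 → ℂ) → ℂ} {x : Fin 3 → ℂ} (hx : x ≠ 0) {r : ℝ} (hr : 0 < r)
    (hg : DifferentiableOn ℂ g (Metric.ball x r))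
    (hzero : ∀ a b c, D.Concurrent a b c → ∀ y ∈ Metric.ball x r,
      D.g a y = 0 → D.g b y = 0 → g y = 0) :
    ∃ W ∈ nhds x, IntegrableOn (fun y => ‖g y‖ ^ 2 * ‖D.f y‖ ^ (-2 * β)) W := by
  obtain ⟨κ, hκ, h⟩ := D.exists_norm_mul_le_of_eq_zero_on_lines
  have hx0 := norm_pos_iff.2 hx
  obtain ⟨B, hB, s, hs, hsr, hsx, hbound⟩ : ∃ B, 0 < B ∧ ∃ s, 0 < s ∧ s ≤ r ∧ s ≤ ‖x‖ / 2 ∧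
      ∀ y ∈ Metric.ball x s, ‖g y‖ ≤ B := by
    have hcont : ContinuousAt g x :=
      (hg.differentiableAt (Metric.ball_mem_nhds x hr)).continuousAt
    have ev : ∀ᶠ y in nhds x, ‖g y‖ < ‖g x‖ + 1 := hcont.norm.eventually_lt_const (by simp)
    obtain ⟨s, hs, hsub⟩ := Metric.eventually_nhds_iff_ball.1 ev
    refine ⟨‖g x‖ + 1, by positivity, min s (min r (‖x‖ / 2)), by positivity,
      (min_le_right _ _).trans (min_le_left _ _), (min_le_right _ _).trans (min_le_right _ _),
      fun y hy => (hsub y (Metric.ball_subset_ball (min_le_left _ _) hy)).le⟩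
  obtain ⟨k, hk⟩ := exists_nat_gt (D.degree * β)
  have hsub : Metric.ball x (s / 2) ⊆ Metric.ball x s := Metric.ball_subset_ball (by linarith)
  set m : ℝ := (‖x‖ / 2) ^ k with hm
  have hm0 : 0 < m := by positivity
  have hnorm : ∀ y ∈ Metric.ball x (s / 2), ‖x‖ / 2 ≤ ‖y‖ ∧ ‖y‖ ≤ 2 * ‖x‖ := by
    intro y hy
    rw [Metric.mem_ball, dist_eq_norm] at hy
    have h1 := norm_sub_norm_le y x
    have h2 := norm_sub_norm_le x y
    rw [norm_sub_rev] at h2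
    constructor <;> linarith
  set A : ℝ := 2 * ‖x‖ * (4 / s * (B * κ)) with hA
  have hA0 : 0 < A := by positivity
  refine ⟨_, Metric.ball_mem_nhds x (half_pos hs), integrableOn_of_norm_le hred hd hmult hβ0 hβ1
    (k := k) (by linarith) (C := (B + A) / m) (by positivity)
    (hg.continuousOn.mono (hsub.trans (Metric.ball_subset_ball hsr))) (fun y hy => ?_)
    (fun y hy a b c habc => ?_)⟩
  · obtain ⟨hy1, -⟩ := hnorm y hy
    have hmy : m ≤ ‖y‖ ^ k := by rw [hm]; gcongr
    calc ‖g y‖ ≤ B := hbound y (hsub hy)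
      _ ≤ B + A := by linarith
      _ = (B + A) / m * m := by field_simp
      _ ≤ _ := by gcongr
  · obtain ⟨hy1, hy2⟩ := hnorm y hy
    have hmy : m ≤ ‖y‖ ^ k := by rw [hm]; gcongr
    have hball : Metric.ball y (2 * (s / 4)) ⊆ Metric.ball x s :=
      Metric.ball_subset_ball' (by have := Metric.mem_ball.1 hy; linarith)
    have hball' := hball.trans (Metric.ball_subset_ball hsr)
    have := h a b habc.1 g y (s / 4) B (by positivity) (hg.mono hball')
      (fun z hz => hbound z (hball hz)) (fun z hz => hzero a b c habc z (hball' hz))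
    set S : ℝ := ‖D.g a y‖ + ‖D.g b y‖ + ‖D.g c y‖ with hS
    have hS0 : 0 ≤ S := by positivity
    calc ‖g y‖ * ‖y‖ = ‖y‖ * (4 / s * (‖g y‖ * (s / 4))) := by field_simp
      _ ≤ 2 * ‖x‖ * (4 / s * (B * (κ * S))) := by
          gcongr ?_ * (_ * ?_)
          refine this.trans ?_
          gcongr
          exact le_add_of_nonneg_right (norm_nonneg _)
      _ = A * S := by rw [hA]; ring
      _ ≤ (B + A) * S := by gcongr; linarith
      _ = (B + A) / m * m * S := by field_simp
      _ ≤ _ := by gcongr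

end Arrangement

theorem exists_leading_term {E : Type*} [NormedAddCommGroup E] [NormedSpace ℂ E] {g : E → ℂ}
    {r C : ℝ} {k : ℕ} (hr : 0 < r) (hC : 0 ≤ C) (hg : DifferentiableOn ℂ g (Metric.ball 0 r))
    (hbound : ∀ y ∈ Metric.ball 0 r, ‖g y‖ ≤ C * ‖y‖ ^ k) :
    ∃ G : E → ℂ, ∀ R : ℝ, 0 < R → ∃ K : ℝ, ∀ y, ‖y‖ ≤ R → ∀ t : ℂ, t ≠ 0 → ‖t‖ * R < r →
      ‖g (t • y) / t ^ k - G y‖ ≤ K * ‖t‖ := by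
  set h : E → ℂ → ℂ := fun y t => g (t • y) / t ^ k with hh
  set G : E → ℂ := fun y => (nhdsWithin 0 {0}ᶜ).limUnder (h y) with hG
  refine ⟨G, fun R hR => ⟨2 * (C * R ^ k) / (r / R), fun y hy t ht htR => ?_⟩⟩
  have hmem : ∀ s ∈ Metric.ball (0 : ℂ) (r / R), s • y ∈ Metric.ball (0 : E) r := by
    intro s hs
    rw [mem_ball_zero_iff, lt_div_iff₀ hR] at hs
    rw [mem_ball_zero_iff, norm_smul]
    exact lt_of_le_of_lt (by gcongr) hs
  have hle : ∀ s ∈ Metric.ball (0 : ℂ) (r / R), s ≠ 0 → ‖h y s‖ ≤ C * R ^ k := by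
    intro s hs hs0
    have := hbound _ (hmem s hs)
    have hs0' := norm_pos_iff.2 hs0
    rw [hh]
    simp only
    rw [norm_div, norm_pow, div_le_iff₀ (by positivity)]
    refine this.trans ?_
    rw [norm_smul, mul_pow]
    calc C * (‖s‖ ^ k * ‖y‖ ^ k) ≤ C * (‖s‖ ^ k * R ^ k) := by gcongr
      _ = _ := by ring
  have hball : Metric.ball (0 : ℂ) (r / R) ∈ nhds 0 := Metric.ball_mem_nhds _ (by positivity)
  have hd : DifferentiableOn ℂ (h y) (Metric.ball 0 (r / R) \ {0}) := by
    refine DifferentiableOn.div ?_ (by fun_prop) (fun s hs => pow_ne_zero _ hs.2)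
    exact hg.comp (by fun_prop) fun s hs => hmem s hs.1
  have hbdd : BddAbove (norm ∘ h y '' (Metric.ball 0 (r / R) \ {0})) := by
    refine ⟨C * R ^ k, ?_⟩
    rintro _ ⟨s, hs, rfl⟩
    exact hle s hs.1 hs.2
  have hdiff := Complex.differentiableOn_update_limUnder_of_bddAbove hball hd hbdd
  have htend : Filter.Tendsto (h y) (nhdsWithin 0 {0}ᶜ) (nhds (G y)) := by
    refine Complex.tendsto_limUnder_of_differentiable_on_punctured_nhds_of_bounded_under
      (f := h y) ?_ ?_
    · filter_upwards [self_mem_nhdsWithin, mem_nhdsWithin_of_mem_nhds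
        (Metric.isOpen_ball.mem_nhds (Metric.mem_ball_self (x := (0 : ℂ)) (ε := r / R)
          (by positivity)))] with s hs hsb
      exact (hd.differentiableAt ((Metric.isOpen_ball.sdiff isClosed_singleton).mem_nhds ⟨hsb, hs⟩))
    · refine ⟨C * R ^ k + ‖h y 0‖, ?_⟩
      rw [Filter.eventually_map]
      filter_upwards [self_mem_nhdsWithin, mem_nhdsWithin_of_mem_nhds hball] with s hs hsb
      exact (norm_sub_le _ _).trans (by gcongr; exact hle s hsb hs)
  have hGle : ‖G y‖ ≤ C * R ^ k := by
    refine le_of_tendsto htend.norm ?_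
    filter_upwards [self_mem_nhdsWithin, mem_nhdsWithin_of_mem_nhds hball] with s hs hsb
    exact hle s hsb hs
  have htb : t ∈ Metric.ball (0 : ℂ) (r / R) := by
    rwa [mem_ball_zero_iff, lt_div_iff₀ hR]
  have := Complex.dist_le_div_mul_dist_of_mapsTo_ball hdiff (R₂ := 2 * (C * R ^ k))
    (fun s hs => by
      rw [Function.update_self, mem_closedBall_iff_norm]
      refine (norm_sub_le _ _).trans ?_
      rw [two_mul]
      refine add_le_add ?_ hGle
      rcases eq_or_ne s 0 with rfl | hs0
      · rw [Function.update_self]; exact hGle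
      · rw [Function.update_of_ne hs0]; exact hle s hs hs0) htb
  rwa [Function.update_self, Function.update_of_ne ht, dist_eq_norm, dist_zero_right] at this

theorem exists_homogeneous_leading_term {E : Type*} [NormedAddCommGroup E] [NormedSpace ℂ E]
    {g : E → ℂ} {r C : ℝ} {k : ℕ} (hr : 0 < r) (hC : 0 ≤ C)
    (hg : DifferentiableOn ℂ g (Metric.ball 0 r))
    (hbound : ∀ y ∈ Metric.ball 0 r, ‖g y‖ ≤ C * ‖y‖ ^ k) :
    ∃ G : E → ℂ,
      (∀ y, Filter.Tendsto (fun t : ℂ => g (t • y) / t ^ k) (nhdsWithin 0 {0}ᶜ) (nhds (G y))) ∧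
      (∀ y, ‖G y‖ ≤ C * ‖y‖ ^ k) ∧
      (∀ y (s : ℂ), s ≠ 0 → G (s • y) = s ^ k * G y) ∧
      (∀ y w, Differentiable ℂ fun s : ℂ => G (y + s • w)) ∧
      ((∀ y, G y = 0) → ∃ C', 0 ≤ C' ∧ ∀ y ∈ Metric.ball 0 r, ‖g y‖ ≤ C' * ‖y‖ ^ (k + 1)) := by
  obtain ⟨G, hG⟩ := exists_leading_term hr hC hg hbound
  have hsmall : ∀ R : ℝ, 0 < R → ∀ᶠ t in nhds (0 : ℂ), ‖t‖ * R < r := by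
    intro R hR
    have : Continuous fun t : ℂ => ‖t‖ * R := by fun_prop
    exact this.continuousAt.eventually_lt_const (by simpa)
  have htend : ∀ y, Filter.Tendsto (fun t : ℂ => g (t • y) / t ^ k) (nhdsWithin 0 {0}ᶜ)
      (nhds (G y)) := by
    intro y
    obtain ⟨K, hK⟩ := hG (‖y‖ + 1) (by positivity)
    rw [tendsto_iff_norm_sub_tendsto_zero]
    refine squeeze_zero' (g := fun t : ℂ => K * ‖t‖)
      (Filter.Eventually.of_forall fun _ => norm_nonneg _) ?_ ?_
    · filter_upwards [self_mem_nhdsWithin, mem_nhdsWithin_of_mem_nhds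
        (hsmall (‖y‖ + 1) (by positivity))] with t ht htr
      exact hK y (by linarith) t ht htr
    · have : Continuous fun t : ℂ => K * ‖t‖ := by fun_prop
      simpa using (this.tendsto 0).mono_left nhdsWithin_le_nhds
  refine ⟨G, htend, fun y => ?_, fun y s hs => ?_, fun y w => ?_, fun h0 => ?_⟩
  · refine le_of_tendsto (htend y).norm ?_
    filter_upwards [self_mem_nhdsWithin, mem_nhdsWithin_of_mem_nhds
      (hsmall (‖y‖ + 1) (by positivity))] with t ht htr
    have ht0 := norm_pos_iff.2 ht
    rw [norm_div, norm_pow, div_le_iff₀ (by positivity)]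
    refine (hbound _ ?_).trans ?_
    · rw [mem_ball_zero_iff, norm_smul]
      nlinarith
    · rw [norm_smul, mul_pow]
      exact le_of_eq (by ring)
  · refine tendsto_nhds_unique (htend (s • y)) ?_
    have hmap : Filter.Tendsto (fun t : ℂ => t * s) (nhdsWithin 0 {0}ᶜ) (nhdsWithin 0 {0}ᶜ) := by
      refine tendsto_nhdsWithin_iff.2 ⟨?_, ?_⟩
      · have : Continuous fun t : ℂ => t * s := by fun_prop
        simpa using (this.tendsto 0).mono_left nhdsWithin_le_nhds
      · filter_upwards [self_mem_nhdsWithin] with t ht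
        exact mul_ne_zero ht hs
    refine (((htend y).comp hmap).const_mul (s ^ k)).congr' ?_
    filter_upwards [self_mem_nhdsWithin] with t ht
    have ht : t ≠ 0 := ht
    simp only [Function.comp_apply, smul_smul]
    field_simp
    ring
  · intro s₀
    set B := Metric.ball s₀ 1 with hB
    have hs₀ : s₀ ∈ B := Metric.mem_ball_self one_pos
    set R := ‖y‖ + (‖s₀‖ + 1) * ‖w‖ + 1 with hR
    have hR0 : 0 < R := by positivity
    have hyR : ∀ s ∈ B, ‖y + s • w‖ ≤ R := by
      intro s hs
      have hs' : ‖s‖ ≤ ‖s₀‖ + 1 := by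
        rw [hB, Metric.mem_ball, dist_eq_norm] at hs
        have := norm_sub_norm_le s s₀
        linarith
      calc ‖y + s • w‖ ≤ ‖y‖ + ‖s‖ * ‖w‖ := by rw [← norm_smul]; exact norm_add_le _ _
        _ ≤ ‖y‖ + (‖s₀‖ + 1) * ‖w‖ := by gcongr
        _ ≤ R := by rw [hR]; linarith
    obtain ⟨K, hK⟩ := hG R hR0
    have hunif : TendstoLocallyUniformlyOn (fun (t : ℂ) s => g (t • (y + s • w)) / t ^ k)
        (fun s => G (y + s • w)) (nhdsWithin 0 {0}ᶜ) B := by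
      refine TendstoUniformlyOn.tendstoLocallyUniformlyOn ?_
      rw [Metric.tendstoUniformlyOn_iff]
      intro ε hε
      have hc : Continuous fun t : ℂ => K * ‖t‖ := by fun_prop
      have : ∀ᶠ t in nhds (0 : ℂ), K * ‖t‖ < ε :=
        hc.continuousAt.eventually_lt_const (by simpa)
      filter_upwards [self_mem_nhdsWithin, mem_nhdsWithin_of_mem_nhds (hsmall R hR0),
        mem_nhdsWithin_of_mem_nhds this] with t ht htr htε s hs
      rw [dist_comm, dist_eq_norm]
      exact (hK _ (hyR s hs) t ht htr).trans_lt htε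
    have hdiff : ∀ᶠ t in nhdsWithin (0 : ℂ) {0}ᶜ,
        DifferentiableOn ℂ (fun s => g (t • (y + s • w)) / t ^ k) B := by
      filter_upwards [mem_nhdsWithin_of_mem_nhds (hsmall R hR0)] with t htr
      refine DifferentiableOn.div_const ?_ _
      refine hg.comp (by fun_prop) fun s hs => ?_
      rw [mem_ball_zero_iff, norm_smul]
      exact lt_of_le_of_lt (mul_le_mul_of_nonneg_left (hyR s hs) (norm_nonneg _)) htr
    exact (hunif.differentiableOn hdiff Metric.isOpen_ball).differentiableAt
      (Metric.isOpen_ball.mem_nhds hs₀)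
  · obtain ⟨K, hK⟩ := hG 1 one_pos
    have hle : ∀ y, ‖y‖ ≤ 1 → ∀ t : ℂ, t ≠ 0 → ‖t‖ < r → ‖g (t • y)‖ ≤ K * ‖t‖ ^ (k + 1) := by
      intro y hy t ht htr
      have := hK y hy t ht (by simpa)
      have ht0 := norm_pos_iff.2 ht
      rw [h0, sub_zero, norm_div, norm_pow, div_le_iff₀ (by positivity)] at this
      rwa [pow_succ', ← mul_assoc]
    refine ⟨max K 0, le_max_right _ _, fun y hy => ?_⟩
    rcases eq_or_ne y 0 with rfl | hy0
    · have hc : Continuous fun t : ℂ => K * ‖t‖ ^ (k + 1) := by fun_prop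
      have hc0 : Filter.Tendsto (fun t : ℂ => K * ‖t‖ ^ (k + 1)) (nhdsWithin 0 {0}ᶜ) (nhds 0) := by
        simpa using (hc.tendsto 0).mono_left nhdsWithin_le_nhds
      rw [norm_zero, zero_pow (Nat.succ_ne_zero k), mul_zero]
      refine ge_of_tendsto hc0 ?_
      filter_upwards [self_mem_nhdsWithin, mem_nhdsWithin_of_mem_nhds (hsmall 1 one_pos)]
        with t ht htr
      simpa using hle 0 (by simp) t ht (by simpa using htr)
    · have hn := norm_pos_iff.2 hy0
      have hnC : (‖y‖ : ℂ) ≠ 0 := by exact_mod_cast hn.ne'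
      have := hle ((‖y‖ : ℂ)⁻¹ • y) (by simp [norm_smul, hn.ne']) (‖y‖ : ℂ) hnC
        (by simpa using hy)
      rw [smul_smul, mul_inv_cancel₀ hnC, one_smul, Complex.norm_real, norm_norm] at this
      refine this.trans ?_
      gcongr
      exact le_max_left _ _

theorem Differentiable.exists_polynomial_of_norm_le {φ : ℂ → ℂ} (hφ : Differentiable ℂ φ) {A : ℝ}
    {k : ℕ} (hA : 0 ≤ A) (hbound : ∀ s, ‖φ s‖ ≤ A * (1 + ‖s‖) ^ k) :
    ∃ p : Polynomial ℂ, p.degree < (k + 1 : ℕ) ∧ ∀ s, φ s = p.eval s := by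
  have hzero : ∀ n, k < n → iteratedDeriv n φ 0 = 0 := by
    intro n hn
    have hle : ∀ R : ℝ, 1 ≤ R → ‖iteratedDeriv n φ 0‖ ≤ n.factorial * (A * 2 ^ k) * R⁻¹ := by
      intro R hR
      have hR0 : 0 < R := by linarith
      refine (Complex.norm_iteratedDeriv_le_of_forall_mem_sphere_norm_le n hR0
        hφ.diffContOnCl (C := A * (2 * R) ^ k) fun z hz => ?_).trans ?_
      · rw [mem_sphere_zero_iff_norm] at hz
        refine (hbound z).trans ?_
        gcongr
        linarith
      · rw [div_le_iff₀ (by positivity), mul_pow]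
        have : R ^ k ≤ R⁻¹ * R ^ n := by
          rw [← div_eq_inv_mul, le_div_iff₀ hR0, ← pow_succ]
          exact pow_le_pow_right₀ hR hn
        calc (n.factorial : ℝ) * (A * (2 ^ k * R ^ k)) = n.factorial * (A * 2 ^ k) * R ^ k := by ring
          _ ≤ n.factorial * (A * 2 ^ k) * (R⁻¹ * R ^ n) := by gcongr
          _ = _ := by ring
    have hlim : Filter.Tendsto (fun R : ℝ => n.factorial * (A * 2 ^ k) * R⁻¹) Filter.atTop
        (nhds 0) := by
      simpa using (tendsto_inv_atTop_zero (𝕜 := ℝ)).const_mul (n.factorial * (A * 2 ^ k))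
    rw [← norm_le_zero_iff]
    refine ge_of_tendsto hlim ?_
    filter_upwards [Filter.eventually_ge_atTop 1] with R hR
    exact hle R hR
  refine ⟨∑ n : Fin (k + 1), Polynomial.C ((n.1.factorial : ℂ)⁻¹ * iteratedDeriv n φ 0) *
    Polynomial.X ^ n.1, Polynomial.degree_sum_fin_lt _, fun s => ?_⟩
  rw [← Complex.taylorSeries_eq_of_entire' 0 s hφ, tsum_eq_sum (s := Finset.range (k + 1)),
    Polynomial.eval_finsetSum, Finset.sum_range]
  · simp
  · intro n hn
    rw [Finset.mem_range, not_lt] at hn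
    rw [hzero n (by omega), mul_zero, zero_mul]

theorem exists_mvPolynomial_of_separately_polynomial {F : (Fin 3 → ℂ) → ℂ} {k : ℕ}
    (hF : ∀ y i, ∃ p : Polynomial ℂ, p.degree < (k + 1 : ℕ) ∧
      ∀ s, F (Function.update y i s) = p.eval s) :
    ∃ Q : MvPolynomial (Fin 3) ℂ, ∀ y, F y = MvPolynomial.eval y Q := by
  set v : ℕ → ℂ := fun n => n with hv
  set S := Finset.range (k + 1) with hS
  have hinj : Set.InjOn v S := fun a _ b _ h => Nat.cast_injective h
  set ℓ : ℕ → Polynomial ℂ := Lagrange.basis S v with hℓ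
  have key : ∀ y i, F y = ∑ a ∈ S, F (Function.update y i (v a)) * (ℓ a).eval (y i) := by
    intro y i
    obtain ⟨p, hp, hpF⟩ := hF y i
    have h1 : F y = p.eval (y i) := by rw [← hpF, Function.update_eq_self]
    rw [h1, Lagrange.eq_interpolate (f := p) (s := S) (v := v) hinj (by simpa [hS] using hp),
      Lagrange.interpolate_apply, Polynomial.eval_finsetSum]
    simp [hpF, hℓ]
  refine ⟨∑ a ∈ S, ∑ b ∈ S, ∑ c ∈ S, MvPolynomial.C (F ![v a, v b, v c]) *
    Polynomial.aeval (MvPolynomial.X 2) (ℓ c) * Polynomial.aeval (MvPolynomial.X 1) (ℓ b) *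
    Polynomial.aeval (MvPolynomial.X 0) (ℓ a), fun y => ?_⟩
  have heval : ∀ (i : Fin 3) (p : Polynomial ℂ),
      MvPolynomial.eval y (Polynomial.aeval (MvPolynomial.X i) p) = p.eval (y i) := by
    intro i p
    rw [← MvPolynomial.coe_aeval_eq_eval]
    change MvPolynomial.aeval y (Polynomial.aeval (MvPolynomial.X i) p) = _
    rw [← Polynomial.aeval_algHom_apply, MvPolynomial.aeval_X, Polynomial.coe_aeval_eq_eval]
  simp only [map_sum, map_mul, heval, MvPolynomial.eval_C]
  rw [key y 0]
  refine Finset.sum_congr rfl fun a _ => ?_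
  rw [key _ 1, Finset.sum_mul]
  refine Finset.sum_congr rfl fun b _ => ?_
  rw [key _ 2, Finset.sum_mul, Finset.sum_mul]
  refine Finset.sum_congr rfl fun c _ => ?_
  have : Function.update (Function.update (Function.update y 0 (v a)) 1 (v b)) 2 (v c) =
      ![v a, v b, v c] := by
    ext i
    fin_cases i <;> simp [Function.update]
  rw [this]
  simp [Function.update]

theorem MvPolynomial.IsHomogeneous.eval_smul_eq_pow_mul {σ R : Type*} [CommRing R]
    {Q : MvPolynomial σ R} {m : ℕ} (hQ : Q.IsHomogeneous m) (s : R) (y : σ → R) :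
    eval (s • y) Q = s ^ m * eval y Q := by
  rw [eval_eq, eval_eq, Finset.mul_sum]
  refine Finset.sum_congr rfl fun d hd => ?_
  have hdeg : d.degree = m := by
    rw [Finsupp.degree_eq_weight_one]
    exact hQ (mem_support_iff.1 hd)
  simp only [Pi.smul_apply, smul_eq_mul, mul_pow, Finset.prod_mul_distrib,
    Finset.prod_pow_eq_pow_sum]
  rw [← hdeg, Finsupp.degree_apply]
  ring

theorem MvPolynomial.eval_smul_eq_sum {σ R : Type*} [CommRing R] (Q : MvPolynomial σ R) (s : R)
    (y : σ → R) : eval (s • y) Q =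
      ∑ m ∈ Finset.range (Q.totalDegree + 1), s ^ m * eval y (homogeneousComponent m Q) := by
  conv_lhs => rw [← Q.sum_homogeneousComponent]
  rw [map_sum]
  refine Finset.sum_congr rfl fun m _ => ?_
  rw [(homogeneousComponent_isHomogeneous m Q).eval_smul_eq_pow_mul]

theorem exists_isHomogeneous_of_homogeneous {F : (Fin 3 → ℂ) → ℂ} {k : ℕ} {A : ℝ} (hA : 0 ≤ A)
    (hdiff : ∀ y w, Differentiable ℂ fun s : ℂ => F (y + s • w))
    (hbound : ∀ y, ‖F y‖ ≤ A * ‖y‖ ^ k)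
    (hhom : ∀ y (s : ℂ), s ≠ 0 → F (s • y) = s ^ k * F y) :
    ∃ Q : MvPolynomial (Fin 3) ℂ, Q.IsHomogeneous k ∧ ∀ y, F y = MvPolynomial.eval y Q := by
  obtain ⟨Q, hQ⟩ := exists_mvPolynomial_of_separately_polynomial (F := F) (k := k) (by
    intro y i
    have hup : ∀ s, Function.update y i s = Function.update y i 0 + s • Pi.single i (1 : ℂ) := by
      intro s
      ext j
      by_cases h : j = i
      · subst h; simp
      · simp [h]
    set z := Function.update y i 0
    refine Differentiable.exists_polynomial_of_norm_le (A := A * (1 + ‖z‖) ^ k) ?_ (by positivity)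
      fun s => ?_
    · simp only [hup]
      exact hdiff _ _
    · rw [hup]
      refine (hbound _).trans ?_
      rw [mul_assoc, ← mul_pow]
      gcongr
      refine (norm_add_le _ _).trans ?_
      rw [norm_smul, Pi.norm_single, norm_one]
      nlinarith [norm_nonneg z, norm_nonneg s])
  refine ⟨MvPolynomial.homogeneousComponent k Q,
    MvPolynomial.homogeneousComponent_isHomogeneous k Q, fun y => ?_⟩
  have hpoly : (∑ m ∈ Finset.range (Q.totalDegree + 1), Polynomial.C
      (MvPolynomial.eval y (MvPolynomial.homogeneousComponent m Q)) * Polynomial.X ^ m) =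
      Polynomial.C (F y) * Polynomial.X ^ k := by
    refine Polynomial.eq_of_infinite_eval_eq _ _ ((Set.finite_singleton (0 : ℂ)).infinite_compl.mono
      fun s hs => ?_)
    have h1 := MvPolynomial.eval_smul_eq_sum Q s y
    rw [← hQ, hhom y s hs] at h1
    simp only [Set.mem_ofPred_eq, Polynomial.eval_finsetSum, Polynomial.eval_mul,
      Polynomial.eval_C, Polynomial.eval_pow, Polynomial.eval_X]
    rw [mul_comm, h1]
    exact Finset.sum_congr rfl fun m _ => mul_comm _ _
  have hcoeff := congrArg (fun p => p.coeff k) hpoly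
  simp only [Polynomial.finsetSum_coeff, Polynomial.coeff_C_mul_X_pow] at hcoeff
  rw [Finset.sum_ite_eq] at hcoeff
  simp only [Finset.mem_range, if_true] at hcoeff
  rw [← hcoeff]
  split_ifs with h
  · rfl
  · rw [MvPolynomial.homogeneousComponent_eq_zero _ _ (by omega), map_zero]

theorem exists_order_or_leading_form {g : (Fin 3 → ℂ) → ℂ} {r C₀ : ℝ} (hr : 0 < r) (hC₀ : 0 ≤ C₀)
    (hg : DifferentiableOn ℂ g (Metric.ball 0 r)) (hbound : ∀ y ∈ Metric.ball 0 r, ‖g y‖ ≤ C₀)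
    (N : ℕ) :
    (∃ C, 0 ≤ C ∧ ∀ y ∈ Metric.ball 0 r, ‖g y‖ ≤ C * ‖y‖ ^ N) ∨
      ∃ k < N, ∃ Q : MvPolynomial (Fin 3) ℂ, Q.IsHomogeneous k ∧ Q ≠ 0 ∧
        ∀ y, Filter.Tendsto (fun t : ℂ => g (t • y) / t ^ k) (nhdsWithin 0 {0}ᶜ)
          (nhds (MvPolynomial.eval y Q)) := by
  induction N with
  | zero => exact Or.inl ⟨C₀, hC₀, by simpa using hbound⟩
  | succ N ih =>
    rcases ih with ⟨C, hC, h⟩ | ⟨k, hk, h⟩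
    · obtain ⟨G, hlim, hle, hhom, hdiff, hzero⟩ := exists_homogeneous_leading_term hr hC hg h
      by_cases hG : ∀ y, G y = 0
      · exact Or.inl (hzero hG)
      · obtain ⟨Q, hQ, hGQ⟩ := exists_isHomogeneous_of_homogeneous hC hdiff hle hhom
        refine Or.inr ⟨N, N.lt_succ_self, Q, hQ, ?_, fun y => hGQ y ▸ hlim y⟩
        rintro rfl
        exact hG fun y => by rw [hGQ, map_zero]
    · exact Or.inr ⟨k, hk.trans N.lt_succ_self, h⟩

theorem MvPolynomial.IsHomogeneous.exists_norm_eval_le {Q : MvPolynomial (Fin 3) ℂ} {k : ℕ}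
    (hQ : Q.IsHomogeneous k) : ∃ C, 0 < C ∧ ∀ y, ‖eval y Q‖ ≤ C * ‖y‖ ^ k := by
  refine ⟨∑ d ∈ Q.support, ‖coeff d Q‖ + 1, by positivity, fun y => ?_⟩
  have h : ‖eval y Q‖ ≤ (∑ d ∈ Q.support, ‖coeff d Q‖) * ‖y‖ ^ k := by
    rw [eval_eq, Finset.sum_mul]
    refine norm_sum_le_of_le _ fun d hd => ?_
    have hdeg : d.degree = k := by
      rw [Finsupp.degree_eq_weight_one]
      exact hQ (mem_support_iff.1 hd)
    rw [norm_mul, norm_prod, ← hdeg, Finsupp.degree_apply, ← Finset.prod_pow_eq_pow_sum]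
    gcongr with i hi
    rw [norm_pow]
    gcongr
    exact norm_le_pi_norm y i
  refine h.trans ?_
  gcongr
  linarith

theorem MvPolynomial.differentiable_eval (Q : MvPolynomial (Fin 3) ℂ) :
    Differentiable ℂ fun y => eval y Q := by
  simp only [eval_eq]
  fun_prop

namespace Arrangement

theorem Concurrent.eq_zero_of_mem_ball {D : Arrangement 3} (hred : D.Reduced)
    {g : (Fin 3 → ℂ) → ℂ} {x : Fin 3 → ℂ} {r : ℝ} (hg : DifferentiableOn ℂ g (Metric.ball x r))
    {β : ℝ} (hβ : 2 / 3 ≤ β)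
    (hint : IntegrableOn (fun y => ‖g y‖ ^ 2 * ‖D.f y‖ ^ (-2 * β)) (Metric.ball x r))
    {a b c : D.ι} (h : D.Concurrent a b c) {y : Fin 3 → ℂ} (hy : y ∈ Metric.ball x r)
    (ha : D.g a y = 0) (hb : D.g b y = 0) : g y = 0 := by
  have hW := Metric.isOpen_ball.mem_nhds hy
  exact h.eq_zero_of_integrableOn hred ha hb (hg.differentiableAt hW).continuousAt hβ hW hint

theorem exists_isHomogeneous_of_mem_JC {D : Arrangement 3} (hred : D.Reduced) (hd : 3 < D.degree)
    (hmult : ∀ V ∈ D.edges, Module.finrank ℂ V = 1 → D.muRed V ≤ 3) {j : ℕ}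
    (hj1 : 2 * D.degree < 3 * j) (hj2 : j < D.degree)
    (hJC : ((j : ℝ) / (D.degree : ℝ)) ∈ D.JC) :
    ∃ Q : MvPolynomial (Fin 3) ℂ, Q ≠ 0 ∧ Q.IsHomogeneous (j - 3) ∧
      ∀ a b c, D.Concurrent a b c → ∀ x, D.g a x = 0 → D.g b x = 0 →
        MvPolynomial.eval x Q = 0 := by
  obtain ⟨hα0, x, U, g, hU, hgU, hlt, hnot⟩ := hJC
  have hd0 : (0 : ℝ) < D.degree := by positivity
  set α : ℝ := (j : ℝ) / D.degree with hα
  have hα1 : α < 1 := by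
    rw [hα, div_lt_one hd0]
    exact_mod_cast hj2
  have hα2 : 2 / 3 < α := by
    rw [hα, div_lt_div_iff₀ (by norm_num) hd0]
    exact_mod_cast (by omega : 2 * D.degree < j * 3)
  have hdα : D.degree * α = j := by
    rw [hα]
    field_simp
  obtain ⟨W, hW, hint⟩ := hlt ((2 / 3 + α) / 2) (by linarith) (by linarith)
  have hcont : ContinuousAt g x := (hgU.differentiableAt hU).continuousAt
  have hev : ∀ᶠ y in nhds x, ‖g y‖ < ‖g x‖ + 1 := hcont.norm.eventually_lt_const (by simp)
  obtain ⟨r, hr, hsub⟩ := Metric.mem_nhds_iff.1 (Filter.inter_mem (Filter.inter_mem hU hW) hev)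
  have hg : DifferentiableOn ℂ g (Metric.ball x r) := hgU.mono fun y hy => (hsub hy).1.1
  have hzero : ∀ a b c, D.Concurrent a b c → ∀ y ∈ Metric.ball x r,
      D.g a y = 0 → D.g b y = 0 → g y = 0 := fun a b c habc y hy ha hb =>
    habc.eq_zero_of_mem_ball hred hg (by linarith)
      (hint.mono_set fun y hy => (hsub hy).1.2) hy ha hb
  obtain rfl : x = 0 := by
    by_contra hx
    obtain ⟨V, hV, hVint⟩ := exists_integrableOn_of_ne_zero hred hd hmult hα0 hα1 hx hr hg hzero
    exact hnot V hV hVint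
  rcases exists_order_or_leading_form hr (by positivity) hg (fun y hy => (hsub hy).2.le) (j - 2)
    with ⟨C, hC, hle⟩ | ⟨k, hk, Q, hQ, hQ0, hlim⟩
  · exfalso
    obtain ⟨V, hV, hVint⟩ := exists_integrableOn_of_norm_le hred hd hmult hα0 hα1 (k := j - 2)
      (C := C + 1) (by rw [hdα]; exact_mod_cast (by omega : j < j - 2 + 3)) hr (by positivity) hg
      (fun y hy => (hle y hy).trans (by gcongr; linarith)) hzero
    exact hnot V hV hVint
  · refine ⟨Q * MvPolynomial.X 0 ^ (j - 3 - k), mul_ne_zero hQ0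
      (pow_ne_zero _ (MvPolynomial.X_ne_zero 0)), ?_, fun a b c habc y ha hb => ?_⟩
    · have := hQ.mul (MvPolynomial.isHomogeneous_X_pow (R := ℂ) (0 : Fin 3) (j - 3 - k))
      rwa [show k + (j - 3 - k) = j - 3 by omega] at this
    · have hball : ∀ᶠ t in nhds (0 : ℂ), t • y ∈ Metric.ball (0 : Fin 3 → ℂ) r := by
        have : Continuous fun t : ℂ => t • y := by fun_prop
        exact this.continuousAt.preimage_mem_nhds (by simpa using Metric.ball_mem_nhds 0 hr)
      have hlim0 : Filter.Tendsto (fun t : ℂ => g (t • y) / t ^ k) (nhdsWithin 0 {0}ᶜ)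
          (nhds 0) := by
        refine tendsto_const_nhds.congr' ?_
        filter_upwards [mem_nhdsWithin_of_mem_nhds hball] with t ht
        rw [hzero a b c habc _ ht (by simp [ha]) (by simp [hb]), zero_div]
      rw [map_mul, tendsto_nhds_unique (hlim y) hlim0, zero_mul]

theorem Reduced.f_smul {D : Arrangement 3} (hred : D.Reduced) (t : ℂ) (y : Fin 3 → ℂ) :
    D.f (t • y) = t ^ D.degree * D.f y := by
  simp [hred.f_apply, hred.degree_eq, Finset.prod_mul_distrib]

theorem mem_JC_of_isHomogeneous {D : Arrangement 3} (hred : D.Reduced) (hd : 3 < D.degree)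
    (hmult : ∀ V ∈ D.edges, Module.finrank ℂ V = 1 → D.muRed V ≤ 3) {j : ℕ}
    (hj1 : 2 * D.degree < 3 * j) (hj2 : j < D.degree) {Q : MvPolynomial (Fin 3) ℂ} (hQ0 : Q ≠ 0)
    (hQ : Q.IsHomogeneous (j - 3))
    (hzero : ∀ a b c, D.Concurrent a b c → ∀ x, D.g a x = 0 → D.g b x = 0 →
      MvPolynomial.eval x Q = 0) :
    ((j : ℝ) / (D.degree : ℝ)) ∈ D.JC := by
  have hd0 : (0 : ℝ) < D.degree := by positivity
  set α : ℝ := (j : ℝ) / D.degree with hα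
  have hα0 : 0 < α := div_pos (by exact_mod_cast (by omega : 0 < j)) hd0
  have hα1 : α < 1 := by
    rw [hα, div_lt_one hd0]
    exact_mod_cast hj2
  have hdα : D.degree * α = j := by
    rw [hα]
    field_simp
  have hj : ((j - 3 : ℕ) : ℝ) + 3 = j := by exact_mod_cast (by omega : j - 3 + 3 = j)
  obtain ⟨C, hC, hle⟩ := hQ.exists_norm_eval_le
  have hdiff := Q.differentiable_eval
  refine ⟨hα0, 0, Set.univ, fun y => MvPolynomial.eval y Q, Filter.univ_mem,
    hdiff.differentiableOn, fun β hβ0 hβ => ?_, fun W hW hint => ?_⟩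
  · refine exists_integrableOn_of_norm_le hred hd hmult hβ0 (hβ.trans hα1) (k := j - 3) ?_ one_pos
      hC hdiff.differentiableOn (fun y _ => hle y) fun a b c habc y _ => hzero a b c habc y
    rw [hj, ← hdα]
    gcongr
  · obtain ⟨r, hr, hsub⟩ := Metric.mem_nhds_iff.1 hW
    obtain ⟨y₀, hy₀, hQy, hfy⟩ : ∃ y, y ≠ 0 ∧ MvPolynomial.eval y Q ≠ 0 ∧ D.f y ≠ 0 := by
      obtain ⟨w, hw⟩ : ∃ w, MvPolynomial.eval w Q ≠ 0 := by
        by_contra! hcon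
        exact hQ0 (MvPolynomial.funext fun w => by rw [hcon, map_zero])
      have hdense : Dense {y | D.f y ≠ 0} := Measure.dense_of_ae D.ae_f_ne_zero
      obtain ⟨y, hy, hfy⟩ := hdense.inter_open_nonempty {y | MvPolynomial.eval y Q ≠ 0}
        (isOpen_ne_fun hdiff.continuous continuous_const) ⟨w, hw⟩
      refine ⟨y, ?_, hy, hfy⟩
      rintro rfl
      refine hfy ?_
      have := hred.f_smul 0 0
      rwa [zero_smul, zero_pow (by omega), zero_mul] at this
    refine not_integrableOn_ball_of_homogeneous volume (fun y => by positivity) ?_ ?_ hy₀ ?_ hr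
      (hint.mono_set hsub)
    · intro t ht y
      have hfr : Module.finrank ℝ (Fin 3 → ℂ) = 6 := by
        simp [Module.finrank_pi_fintype, Complex.finrank_real_complex]
      have hsm : t • y = (t : ℂ) • y := rfl
      beta_reduce
      rw [hfr, hsm, hQ.eval_smul_eq_pow_mul, hred.f_smul]
      simp only [norm_mul, norm_pow, Complex.norm_real, Real.norm_of_nonneg ht.le]
      rw [Real.mul_rpow (by positivity) (norm_nonneg _), mul_pow]
      have : (t ^ (j - 3)) ^ 2 * (t ^ D.degree) ^ (-2 * α) = (t ^ 6)⁻¹ := by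
        rw [← pow_mul, ← Real.rpow_natCast t (_ * 2), ← Real.rpow_natCast t D.degree,
          ← Real.rpow_natCast t 6, ← Real.rpow_mul ht.le, ← Real.rpow_add ht, ← Real.rpow_neg ht.le]
        congr 1
        push_cast
        linear_combination 2 * hj - 2 * hdα
      rw [← this]
      ring
    · intro y hy
      have hfy : D.f y ≠ 0 := by
        intro h0
        refine hy ?_
        simp only [h0, norm_zero]
        rw [Real.zero_rpow (by nlinarith), mul_zero]
      exact (hdiff.continuous.norm.pow 2).continuousAt.mul
        (D.continuous_f.norm.continuousAt.rpow_const (Or.inl (norm_ne_zero_iff.2 hfy)))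
    · exact mul_ne_zero (pow_ne_zero _ (norm_ne_zero_iff.2 hQy))
        (Real.rpow_pos_of_pos (norm_pos_iff.2 hfy) _).ne'

end Arrangement

/-- **Statement (0.1).** For a reduced essential central arrangement `D` in `ℂ³` with
multiplicity at most `3` along every line, and `α = j/d ∈ (2/3, 1)`, `α` is a jumping
coefficient iff there is a nonzero homogeneous polynomial of degree `j−3` vanishing on all
1-dimensional edges of multiplicity `3`. -/
theorem jc_dim3_mult3_criterion (D : Arrangement 3) (hred : D.Reduced) (hess : D.Essential)
    (hd : 3 < D.degree)
    (hmult : ∀ V ∈ D.edges, Module.finrank ℂ V = 1 → D.muRed V ≤ 3)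
    (j : ℕ) (hj1 : 2 * D.degree < 3 * j) (hj2 : j < D.degree) :
    ((j : ℝ) / (D.degree : ℝ)) ∈ D.JC ↔
      ∃ g : MvPolynomial (Fin 3) ℂ, g ≠ 0 ∧ g.IsHomogeneous (j - 3) ∧
        ∀ V ∈ D.edges, Module.finrank ℂ V = 1 → D.muRed V = 3 →
          ∀ x : Fin 3 → ℂ, x ∈ V → MvPolynomial.eval x g = 0 := by
  have hiff := fun g : MvPolynomial (Fin 3) ℂ =>
    D.forall_edge_iff_forall_concurrent hmult fun x => MvPolynomial.eval x g = 0
  simp only [hiff]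
  refine ⟨fun h => Arrangement.exists_isHomogeneous_of_mem_JC hred hd hmult hj1 hj2 h, ?_⟩
  rintro ⟨Q, hQ0, hQ, hzero⟩
  exact Arrangement.mem_JC_of_isHomogeneous hred hd hmult hj1 hj2 hQ0 hQ hzero
end
end

section
/- Let f(x,y,z) = (x²−y²)(x²−z²)(y²−z²)z, defining a central essential arrangement D of 7 planes in ℂ³. Then 5/7 is not a jumping coefficient of D: for every point x ∈ ℂ³ and every function g holomorphic on a neighborhood of x, if |g|²·|f|^{−2β} is Lebesgue-integrable on some neighborhood of x for every β ∈ (0, 5/7), then |g|²·|f|^{−10/7} is Lebesgue-integrable on some neighborhood of x. (Example 3.6; this gives a negative answer to Mustaţă's Question 2.7.) -/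
open MeasureTheory

noncomputable section

/-- The defining polynomial `f = (x²−y²)(x²−z²)(y²−z²)z` of the arrangement of 7 planes
in `ℂ³` of Example 3.6. -/
def exampleF (y : Fin 3 → ℂ) : ℂ :=
  (y 0 ^ 2 - y 1 ^ 2) * (y 0 ^ 2 - y 2 ^ 2) * (y 1 ^ 2 - y 2 ^ 2) * y 2

/-- The coefficient vectors of the seven linear forms whose product is `exampleF`. -/
def planeCoeff : Fin 7 → Fin 3 → ℤ :=
  ![![1, -1, 0], ![1, 1, 0], ![1, 0, -1], ![1, 0, 1], ![0, 1, -1], ![0, 1, 1], ![0, 0, 1]]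

/-- The linear forms `x - y, x + y, x - z, x + z, y - z, y + z, z`. -/
def planeForm (i : Fin 7) (y : Fin 3 → ℂ) : ℂ :=
  planeCoeff i 0 * y 0 + planeCoeff i 1 * y 1 + planeCoeff i 2 * y 2

/-- The determinant of three of the linear forms. -/
def coeffDet (a b c : Fin 7) : ℤ :=
  planeCoeff a 0 * (planeCoeff b 1 * planeCoeff c 2 - planeCoeff b 2 * planeCoeff c 1) -
  planeCoeff a 1 * (planeCoeff b 0 * planeCoeff c 2 - planeCoeff b 2 * planeCoeff c 0) +
  planeCoeff a 2 * (planeCoeff b 0 * planeCoeff c 1 - planeCoeff b 1 * planeCoeff c 0)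

/-- The planes other than `a` and `b` which contain the intersection of `a` and `b`. -/
def pencil (a b : Fin 7) : Finset (Fin 7) :=
  {c | (c ≠ a ∧ c ≠ b) ∧ coeffDet a b c = 0}

/-- The planes which do not contain the intersection of `a` and `b`. -/
def coPencil (a b : Fin 7) : Finset (Fin 7) :=
  {c | (c ≠ a ∧ c ≠ b) ∧ coeffDet a b c ≠ 0}

theorem card_pencil {a b : Fin 7} (h : a ≠ b) :
    ((pencil a b).card = 0 ∧ (coPencil a b).card = 5) ∨
      ((pencil a b).card = 1 ∧ (coPencil a b).card = 4) := by
  revert a b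
  decide

theorem exists_coeffDet_ne_zero {a b : Fin 7} (h : a ≠ b) : ∃ c, coeffDet a b c ≠ 0 := by
  revert a b
  decide

theorem exists_coeff_combination {a b c : Fin 7} (h : a ≠ b) (hc : c ∈ pencil a b) :
    ∃ s ∈ Finset.Icc (-4 : ℤ) 4, ∃ t ∈ Finset.Icc (-4 : ℤ) 4,
      ∀ k, 2 * planeCoeff c k = s * planeCoeff a k + t * planeCoeff b k := by
  revert a b c
  decide

theorem prod_split {a b : Fin 7} (h : a ≠ b) (w : Fin 7 → ℝ) :
    ∏ c, w c = w a * w b * ((∏ c ∈ pencil a b, w c) * ∏ c ∈ coPencil a b, w c) := by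
  rw [← Finset.mul_prod_erase Finset.univ w (Finset.mem_univ a),
    ← Finset.mul_prod_erase (Finset.univ.erase a) w
      (Finset.mem_erase.2 ⟨h.symm, Finset.mem_univ b⟩),
    ← mul_assoc, ← Finset.prod_filter_mul_prod_filter_not _ (fun c => coeffDet a b c = 0) w]
  congr 3 <;> ext c <;> simp [pencil, coPencil, and_comm]

theorem norm_exampleF (y : Fin 3 → ℂ) : ‖exampleF y‖ = ∏ c, ‖planeForm c y‖ := by
  rw [← norm_prod]
  congr 1
  simp [exampleF, Fin.prod_univ_seven, planeForm, planeCoeff]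
  exact Or.inl (by ring)

theorem norm_planeForm_le (c : Fin 7) (y : Fin 3 → ℂ) : ‖planeForm c y‖ ≤ 3 * ‖y‖ := by
  have hc : ∀ c k, |planeCoeff c k| ≤ 1 := by decide
  have h (k : Fin 3) : ‖(planeCoeff c k : ℂ) * y k‖ ≤ ‖y‖ := by
    rw [norm_mul, Complex.norm_intCast]
    have := norm_le_pi_norm y k
    have h2 : |(planeCoeff c k : ℝ)| ≤ 1 := by exact_mod_cast hc c k
    nlinarith [norm_nonneg (y k)]
  calc _ ≤ _ := norm_add₃_le
    _ ≤ 3 * ‖y‖ := by linarith [h 0, h 1, h 2]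

theorem continuous_planeForm (c : Fin 7) : Continuous (planeForm c) := by
  unfold planeForm
  fun_prop

theorem norm_planeForm_le_of_mem_pencil {a b c : Fin 7} (h : a ≠ b) (hc : c ∈ pencil a b)
    {y : Fin 3 → ℂ} {ε : ℝ} (ha : ‖planeForm a y‖ ≤ ε) (hb : ‖planeForm b y‖ ≤ ε) :
    ‖planeForm c y‖ ≤ 4 * ε := by
  obtain ⟨s, hs, t, ht, hst⟩ := exists_coeff_combination h hc
  have key : 2 * planeForm c y = s * planeForm a y + t * planeForm b y := by
    have h' (k : Fin 3) : 2 * (planeCoeff c k : ℂ) = s * planeCoeff a k + t * planeCoeff b k := by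
      exact_mod_cast hst k
    simp only [planeForm]
    linear_combination y 0 * h' 0 + y 1 * h' 1 + y 2 * h' 2
  have hn := congrArg norm key
  have hs' : |(s : ℝ)| ≤ 4 := by exact_mod_cast abs_le.2 (Finset.mem_Icc.1 hs)
  have ht' : |(t : ℝ)| ≤ 4 := by exact_mod_cast abs_le.2 (Finset.mem_Icc.1 ht)
  have h3 := norm_add_le ((s : ℂ) * planeForm a y) (t * planeForm b y)
  rw [← hn, norm_mul, norm_mul, norm_mul, Complex.norm_intCast, Complex.norm_intCast,
    Complex.norm_two] at h3
  nlinarith [mul_le_mul hs' ha (norm_nonneg _) (by norm_num),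
    mul_le_mul ht' hb (norm_nonneg _) (by norm_num)]

/-- Three linear forms with nonzero determinant are linear coordinates on `ℂ³`. -/
theorem exists_coordinates {a b c : Fin 7} (h : coeffDet a b c ≠ 0) :
    ∃ Φ : (Fin 3 → ℂ) ≃L[ℂ] (Fin 3 → ℂ),
      ∀ y, Φ y = ![planeForm a y, planeForm b y, planeForm c y] := by
  let M : Matrix (Fin 3) (Fin 3) ℂ :=
    .of ![fun k => planeCoeff a k, fun k => planeCoeff b k, fun k => planeCoeff c k]
  have hM : IsUnit M.det := by
    rw [isUnit_iff_ne_zero]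
    have : M.det = (coeffDet a b c : ℂ) := by
      rw [Matrix.det_fin_three]
      simp [M, coeffDet]
      ring
    rw [this]
    exact_mod_cast h
  refine ⟨(Matrix.toLin'OfInv (Matrix.nonsing_inv_mul M hM)
    (Matrix.mul_nonsing_inv M hM)).toContinuousLinearEquiv, fun y => ?_⟩
  ext i
  fin_cases i <;> simp [M, planeForm, Matrix.mulVec, dotProduct, Fin.sum_univ_three]

theorem exists_norm_le_of_coeffDet_ne_zero {a b c : Fin 7} (h : coeffDet a b c ≠ 0) :
    ∃ K : ℝ, 0 < K ∧ ∀ (y : Fin 3 → ℂ) (ε : ℝ), ‖planeForm a y‖ ≤ ε → ‖planeForm b y‖ ≤ ε →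
      ‖planeForm c y‖ ≤ ε → ‖y‖ ≤ K * ε := by
  obtain ⟨Φ, hΦ⟩ := exists_coordinates h
  refine ⟨‖(Φ.symm : (Fin 3 → ℂ) →L[ℂ] (Fin 3 → ℂ))‖ + 1, by positivity, fun y ε h1 h2 h3 => ?_⟩
  have hε : 0 ≤ ε := (norm_nonneg _).trans h1
  have h4 : ‖Φ y‖ ≤ ε := by
    rw [pi_norm_le_iff_of_nonneg hε, hΦ]
    intro i
    fin_cases i <;> simpa
  have h5 := (Φ.symm : (Fin 3 → ℂ) →L[ℂ] (Fin 3 → ℂ)).le_opNorm (Φ y)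
  simp only [ContinuousLinearEquiv.coe_coe, ContinuousLinearEquiv.symm_apply_apply] at h5
  nlinarith [norm_nonneg (Φ.symm : (Fin 3 → ℂ) →L[ℂ] (Fin 3 → ℂ)),
    mul_le_mul_of_nonneg_left h4 (norm_nonneg (Φ.symm : (Fin 3 → ℂ) →L[ℂ] (Fin 3 → ℂ)))]

theorem exists_map_volume_eq_smul (Φ : (Fin 3 → ℂ) ≃L[ℂ] (Fin 3 → ℂ)) :
    ∃ k : NNReal, 0 < k ∧ Measure.map Φ volume = k • (volume : Measure (Fin 3 → ℂ)) :=
  haveI := Φ.isAddHaarMeasure_map volume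
  ⟨_, Measure.addHaarScalarFactor_pos_of_isAddHaarMeasure (Measure.map Φ volume) volume,
    Measure.isAddLeftInvariant_eq_smul _ _⟩

theorem integrableOn_norm_rpow_ball {s : ℝ} (hs : s < 2) (R : ℝ) :
    IntegrableOn (fun z : ℂ => ‖z‖ ^ (-s)) (Metric.ball 0 R) := by
  rcases le_or_gt R 0 with hR | hR
  · simp [Metric.ball_eq_empty.2 hR]
  rw [integrableOn_fun_norm_addHaar volume (f := fun t => t ^ (-s))]
  refine ((intervalIntegral.integrableOn_Ioo_rpow_iff (s := 1 - s) hR).2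
    (by linarith)).congr_fun (fun t ht => ?_) measurableSet_Ioo
  simp [Complex.finrank_real_complex, sub_eq_add_neg, Real.rpow_add ht.1]

theorem integrableOn_prod_norm_rpow (Φ : (Fin 3 → ℂ) ≃L[ℂ] (Fin 3 → ℂ)) {s : ℝ} (hs : s < 2)
    (R : ℝ) : IntegrableOn (fun y => ∏ i, ‖Φ y i‖ ^ (-s)) (Metric.ball 0 R) := by
  set R' := ‖(Φ : (Fin 3 → ℂ) →L[ℂ] (Fin 3 → ℂ))‖ * R + 1
  have hF : Integrable (fun z : Fin 3 → ℂ =>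
      ∏ i, (Metric.ball (0 : ℂ) R').indicator (fun w => ‖w‖ ^ (-s)) (z i)) :=
    Integrable.fintype_prod fun _ =>
      (integrable_indicator_iff measurableSet_ball).2 (integrableOn_norm_rpow_ball hs R')
  obtain ⟨k, -, hk⟩ := exists_map_volume_eq_smul Φ
  have hF' := hF.smul_measure_nnreal (c := k)
  rw [← hk] at hF'
  refine (Φ.toHomeomorph.measurableEmbedding.integrable_map_iff.1 hF').integrableOn.congr_fun
    (fun y hy => ?_) measurableSet_ball
  refine Finset.prod_congr rfl fun i _ => Set.indicator_of_mem ?_ _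
  rw [mem_ball_zero_iff] at hy ⊢
  have h1 := (Φ : (Fin 3 → ℂ) →L[ℂ] (Fin 3 → ℂ)).le_opNorm y
  have h2 := norm_le_pi_norm (Φ y) i
  have h3 := mul_le_mul_of_nonneg_left hy.le (norm_nonneg (Φ : (Fin 3 → ℂ) →L[ℂ] (Fin 3 → ℂ)))
  exact (h2.trans (h1.trans h3)).trans_lt (lt_add_one _)

theorem exists_measureReal_preimage_box (Φ : (Fin 3 → ℂ) ≃L[ℂ] (Fin 3 → ℂ)) :
    ∃ k : ℝ, 0 < k ∧ ∀ (q : Fin 3 → ℂ) (r : Fin 3 → ℝ), (∀ i, 0 ≤ r i) →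
      volume.real (Φ ⁻¹' Set.univ.pi fun i => Metric.ball (q i) (r i)) = k * ∏ i, r i ^ 2 := by
  obtain ⟨k, hk0, hk⟩ := exists_map_volume_eq_smul Φ
  refine ⟨k * Real.pi ^ 3, by positivity, fun q r hr => ?_⟩
  have h : Measure.map Φ volume (Set.univ.pi fun i => Metric.ball (q i) (r i)) = _ :=
    Φ.toHomeomorph.measurableEmbedding.map_apply _ _
  change _ = volume (Φ ⁻¹' _) at h
  rw [Measure.real, ← h, hk, Measure.smul_apply, volume_pi_pi]
  simp [Complex.volume_ball, Fin.prod_univ_three, ENNReal.smul_def, hr]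
  ring

/-- A nonnegative function which blows up at least like `r ^ (-τ)`, `τ > 4`, in the distance `r`
to a complex line is not integrable near the points of the line. -/
theorem not_integrableOn_of_rpow_le (Φ : (Fin 3 → ℂ) ≃L[ℂ] (Fin 3 → ℂ)) {p : Fin 3 → ℂ}
    (h0 : Φ p 0 = 0) (h1 : Φ p 1 = 0) {W : Set (Fin 3 → ℂ)} (hW : W ∈ nhds p)
    {F : (Fin 3 → ℂ) → ℝ} (hF0 : ∀ y, 0 ≤ F y) {c τ : ℝ} (hc : 0 < c) (hτ : 4 < τ)
    (hF : ∀ᵐ y, y ∈ W → ∀ ε, 0 < ε → ‖Φ y 0‖ ≤ ε → ‖Φ y 1‖ ≤ ε → c * ε ^ (-τ) ≤ F y) :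
    ¬ IntegrableOn F W := by
  intro hgint
  have hW' : Φ.symm ⁻¹' W ∈ nhds (Φ p) :=
    Φ.symm.continuous.continuousAt.preimage_mem_nhds (by simpa using hW)
  obtain ⟨δ, hδ, hball⟩ := Metric.mem_nhds_iff.1 hW'
  obtain ⟨k, hk, hvol⟩ := exists_measureReal_preimage_box Φ
  have key : ∀ ε, 0 < ε → ε < δ → k * δ ^ 2 * c * ε ^ (-(τ - 4)) ≤ ∫ y in W, F y := by
    intro ε hε hεδ
    set r : Fin 3 → ℝ := ![ε, ε, δ]
    set S := Φ ⁻¹' Set.univ.pi fun i => Metric.ball (Φ p i) (r i) with hS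
    have hr : ∀ i, 0 ≤ r i := by intro i; fin_cases i <;> simp [r, hε.le, hδ.le]
    have hrδ : ∀ i, r i ≤ δ := by intro i; fin_cases i <;> simp [r, hεδ.le]
    have hSW : S ⊆ W := by
      intro y hy
      have : Φ y ∈ Metric.ball (Φ p) δ := by
        rw [Metric.mem_ball, dist_pi_lt_iff hδ]
        exact fun i => (hy i trivial).trans_le (hrδ i)
      simpa using hball this
    have hSm : MeasurableSet S :=
      Φ.continuous.measurable (MeasurableSet.univ_pi fun i => measurableSet_ball)
    have hSv : volume.real S = k * (ε ^ 2 * ε ^ 2 * δ ^ 2) := by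
      rw [hS, hvol _ _ hr]; simp [r, Fin.prod_univ_three]
    have hSfin : volume S ≠ ⊤ := by
      intro h
      have : volume.real S = 0 := by simp [Measure.real, h]
      rw [hSv] at this
      have : 0 < k * (ε ^ 2 * ε ^ 2 * δ ^ 2) := by positivity
      linarith
    calc k * δ ^ 2 * c * ε ^ (-(τ - 4)) = ∫ y in S, c * ε ^ (-τ) := by
          rw [setIntegral_const, hSv, smul_eq_mul, neg_sub, sub_eq_add_neg, Real.rpow_add hε,
            Real.rpow_ofNat]
          ring
      _ ≤ ∫ y in S, F y := by
          refine setIntegral_mono_on_ae (integrableOn_const hSfin) (hgint.mono_set hSW) hSm ?_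
          filter_upwards [hF] with y hy hyS
          refine hy (hSW hyS) ε hε ?_ ?_
          · have := hyS 0 trivial
            simp only [Metric.mem_ball, h0, dist_zero_right] at this
            exact this.le
          · have := hyS 1 trivial
            simp only [Metric.mem_ball, h1, dist_zero_right] at this
            exact this.le
      _ ≤ ∫ y in W, F y :=
          setIntegral_mono_set hgint (Filter.Eventually.of_forall hF0) hSW.eventuallyLE
  have hlim := (tendsto_rpow_neg_nhdsGT_zero (y := -(τ - 4)) (by linarith)).const_mul_atTop
    (show 0 < k * δ ^ 2 * c by positivity)
  obtain ⟨ε, h, hε, hεδ⟩ := ((hlim.eventually_gt_atTop (∫ y in W, F y)).and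
    (Ioo_mem_nhdsGT hδ)).exists
  exact absurd (key ε hε hεδ) (not_le.2 h)

theorem differentiableAt_fderiv_apply {g : (Fin 3 → ℂ) → ℂ} {x : Fin 3 → ℂ}
    (hg : ∀ᶠ y in nhds x, DifferentiableAt ℂ g y) (v : Fin 3 → ℂ) :
    DifferentiableAt ℂ (fun y => fderiv ℂ g y v) x := by
  obtain ⟨R, hR, hball⟩ := Metric.eventually_nhds_iff_ball.1 (hg.and
    (hg.self_of_nhds.continuousAt.norm.eventually_le_const (lt_add_one ‖g x‖)))
  set M := ‖g x‖ + 1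
  have hbound : ∀ z ∈ Metric.ball x (R / 2), ‖fderiv ℂ g z‖ ≤ 2 * M / (R / 2) := by
    intro z hz
    have hsub : Metric.ball z (R / 2) ⊆ Metric.ball x R :=
      Metric.ball_subset_ball' (by rw [Metric.mem_ball] at hz; linarith)
    refine Complex.norm_fderiv_le_div_of_mapsTo_ball
      (fun y hy => (hball y (hsub hy)).1.differentiableWithinAt) (fun y hy => ?_) (by positivity)
    rw [mem_closedBall_iff_norm]
    have h1 := (hball y (hsub hy)).2
    have h2 := (hball z (hsub (Metric.mem_ball_self (by positivity)))).2
    linarith [norm_sub_le (g y) (g z)]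
  set ρ := R / 4 / (‖v‖ + 1) with hρ
  have hρ0 : 0 < ρ := by positivity
  have hρv : ρ * ‖v‖ < R / 4 := by
    have : ρ * (‖v‖ + 1) = R / 4 := by rw [hρ]; field_simp
    linarith
  have hmem : ∀ y ∈ Metric.ball x (R / 4), ∀ ζ : ℂ, ‖ζ‖ ≤ ρ →
      y + ζ • v ∈ Metric.ball x (R / 2) := by
    intro y hy ζ hζ
    rw [mem_ball_iff_norm] at hy ⊢
    have h1 : ‖ζ • v‖ ≤ ρ * ‖v‖ := by rw [norm_smul]; gcongr
    have h2 : y + ζ • v - x = (y - x) + ζ • v := by abel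
    rw [h2]
    linarith [norm_add_le (y - x) (ζ • v)]
  have hdiff : ∀ z ∈ Metric.ball x (R / 2), DifferentiableAt ℂ g z := fun z hz =>
    (hball z (Metric.ball_subset_ball (by linarith) hz)).1
  have hcm : ∀ θ, ‖circleMap 0 ρ θ‖ ≤ ρ := fun θ => by simp [abs_of_pos hρ0]
  set k : ℝ → ℂ := fun θ => deriv (circleMap 0 ρ) θ * (1 / (circleMap 0 ρ θ - 0) ^ (1 + 1)) with hk
  have hkc : Continuous k := by
    simp only [hk, deriv_circleMap, sub_zero]
    exact ((continuous_circleMap 0 ρ).mul continuous_const).mul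
      (continuous_const.div ((continuous_circleMap 0 ρ).pow _)
        fun θ => pow_ne_zero _ (circleMap_ne_center hρ0.ne'))
  have hformula : ∀ y ∈ Metric.ball x (R / 4),
      (2 * Real.pi * Complex.I)⁻¹ *
        (∫ θ in (0 : ℝ)..2 * Real.pi, k θ * g (y + circleMap 0 ρ θ • v)) =
        fderiv ℂ g y v := by
    intro y hy
    have hline : ∀ ζ ∈ Metric.closedBall (0 : ℂ) ρ,
        DifferentiableAt ℂ (fun ζ : ℂ => g (y + ζ • v)) ζ :=
      fun ζ hζ => (hdiff _ (hmem y hy ζ (by simpa using hζ))).comp ζ (by fun_prop)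
    have hd : DiffContOnCl ℂ (fun ζ : ℂ => g (y + ζ • v)) (Metric.ball 0 ρ) := by
      refine DifferentiableOn.diffContOnCl fun ζ hζ => (hline ζ ?_).differentiableWithinAt
      exact Metric.closure_ball_subset_closedBall hζ
    have h := hd.circleIntegral_one_div_sub_center_pow_smul hρ0 1
    have h' : deriv (fun ζ : ℂ => g (y + ζ • v)) 0 = fderiv ℂ g y v := by
      have hgy : HasFDerivAt g (fderiv ℂ g y) (y + (0 : ℂ) • v) := by
        simpa using (hdiff y (by simpa using hmem y hy 0 (by simpa using hρ0.le))).hasFDerivAt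
      have hl : HasDerivAt (fun ζ : ℂ => y + ζ • v) v 0 := by
        simpa using ((hasDerivAt_id (0 : ℂ)).smul_const v).const_add y
      exact (hgy.comp_hasDerivAt 0 hl).deriv
    rw [iteratedDeriv_one, h'] at h
    simp only [circleIntegral, smul_eq_mul, ← mul_assoc, Nat.factorial_one, Nat.cast_one,
      div_one] at h
    rw [h, inv_mul_cancel_left₀ Complex.two_pi_I_ne_zero]
  have hgint : HasFDerivAt
      (fun y => ∫ θ in (0 : ℝ)..2 * Real.pi, k θ * g (y + circleMap 0 ρ θ • v))
      (∫ θ in (0 : ℝ)..2 * Real.pi, k θ • fderiv ℂ g (x + circleMap 0 ρ θ • v)) x := by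
    have hcont : ∀ y ∈ Metric.ball x (R / 4),
        Continuous fun θ => k θ * g (y + circleMap 0 ρ θ • v) := by
      intro y hy
      refine hkc.mul (continuous_iff_continuousAt.2 fun θ => ?_)
      refine ContinuousAt.comp (f := fun θ => y + circleMap 0 ρ θ • v)
        (hdiff _ (hmem y hy _ (hcm θ))).continuousAt ?_
      exact (continuous_const.add ((continuous_circleMap 0 ρ).smul continuous_const)).continuousAt
    have hx : x ∈ Metric.ball x (R / 4) := Metric.mem_ball_self (by positivity)
    refine intervalIntegral.hasFDerivAt_integral_of_dominated_of_fderiv_le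
      (s := Metric.ball x (R / 4)) (bound := fun θ => ‖k θ‖ * (2 * M / (R / 2)))
      (F' := fun y θ => k θ • fderiv ℂ g (y + circleMap 0 ρ θ • v))
      (Metric.ball_mem_nhds x (by positivity)) ?_ ?_ ?_ ?_ ?_ ?_
    · filter_upwards [Metric.ball_mem_nhds x (show 0 < R / 4 by positivity)] with y hy
      exact (hcont y hy).aestronglyMeasurable
    · exact (hcont x hx).intervalIntegrable _ _
    · have : Measurable fun θ => fderiv ℂ g (x + circleMap 0 ρ θ • v) :=
        (measurable_fderiv ℂ g).comp
          (continuous_const.add ((continuous_circleMap 0 ρ).smul continuous_const)).measurable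
      exact (hkc.measurable.smul this).aestronglyMeasurable
    · refine Filter.Eventually.of_forall fun θ _ y hy => ?_
      rw [norm_smul]
      exact mul_le_mul_of_nonneg_left (hbound _ (hmem y hy _ (hcm θ))) (norm_nonneg _)
    · exact (hkc.norm.mul continuous_const).intervalIntegrable _ _
    · refine Filter.Eventually.of_forall fun θ _ y hy => ?_
      have h1 := (hdiff _ (hmem y hy _ (hcm θ))).hasFDerivAt
      exact ((hasFDerivAt_comp_add_right (circleMap 0 ρ θ • v)).2 h1).const_mul (k θ)
  refine (hgint.differentiableAt.const_mul
    ((2 * Real.pi * Complex.I)⁻¹ : ℂ)).congr_of_eventuallyEq ?_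
  filter_upwards [Metric.ball_mem_nhds x (show 0 < R / 4 by positivity)] with y hy
  exact (hformula y hy).symm

theorem differentiableAt_fderiv {g : (Fin 3 → ℂ) → ℂ} {x : Fin 3 → ℂ}
    (hg : ∀ᶠ y in nhds x, DifferentiableAt ℂ g y) : DifferentiableAt ℂ (fderiv ℂ g) x := by
  have h : fderiv ℂ g = fun y => ∑ i, fderiv ℂ g y (Pi.single i 1) •
      (ContinuousLinearMap.proj i : (Fin 3 → ℂ) →L[ℂ] ℂ) := by
    ext1 y
    refine ContinuousLinearMap.coe_injective (LinearMap.pi_ext' fun i => LinearMap.ext_ring ?_)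
    simp [Pi.single_apply]
  rw [h]
  exact DifferentiableAt.fun_sum fun i _ => (differentiableAt_fderiv_apply hg _).smul_const _

theorem derivatives_eq_zero_of_eventually_line {g : (Fin 3 → ℂ) → ℂ}
    (hg : ∀ᶠ y in nhds 0, DifferentiableAt ℂ g y) {v : Fin 3 → ℂ}
    (hv : ∀ᶠ t : ℂ in nhds 0, g (t • v) = 0) :
    fderiv ℂ g 0 v = 0 ∧ fderiv ℂ (fderiv ℂ g) 0 v v = 0 := by
  have hl (t : ℂ) : HasDerivAt (fun t : ℂ => t • v) v t := by
    simpa using (hasDerivAt_id t).smul_const v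
  have hlim : Filter.Tendsto (fun t : ℂ => t • v) (nhds 0) (nhds 0) := by
    simpa using (hl 0).continuousAt.tendsto
  have h1 : ∀ᶠ t : ℂ in nhds 0, fderiv ℂ g (t • v) v = 0 := by
    filter_upwards [hv.eventually_nhds, hlim.eventually hg] with t ht hd
    have h := hd.hasFDerivAt.comp_hasDerivAt t (hl t)
    exact h.unique ((hasDerivAt_const t (0 : ℂ)).congr_of_eventuallyEq ht)
  refine ⟨by simpa using h1.self_of_nhds, ?_⟩
  have hd : HasFDerivAt (fderiv ℂ g) (fderiv ℂ (fderiv ℂ g) 0) ((0 : ℂ) • v) := by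
    simpa using (differentiableAt_fderiv hg).hasFDerivAt
  have h2 : HasDerivAt (fun t : ℂ => fderiv ℂ g (t • v) v) (fderiv ℂ (fderiv ℂ g) 0 v v) 0 :=
    (ContinuousLinearMap.apply ℂ ℂ v).hasFDerivAt.comp_hasDerivAt 0 (hd.comp_hasDerivAt 0 (hl 0))
  exact h2.unique ((hasDerivAt_const (0 : ℂ) (0 : ℂ)).congr_of_eventuallyEq h1)

/-- No nonzero linear or quadratic form vanishes on the six triple lines of the arrangement. -/
theorem derivatives_eq_zero {g : (Fin 3 → ℂ) → ℂ}
    (hg : ∀ᶠ y in nhds 0, DifferentiableAt ℂ g y)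
    (hline : ∀ a b, a ≠ b → (pencil a b).Nonempty →
      ∀ᶠ y in nhds 0, planeForm a y = 0 → planeForm b y = 0 → g y = 0) :
    fderiv ℂ g 0 = 0 ∧ fderiv ℂ (fderiv ℂ g) 0 = 0 := by
  have key (a b : Fin 7) (hab : a ≠ b) (hp : (pencil a b).Nonempty) (v : Fin 3 → ℂ)
      (ha : planeForm a v = 0) (hb : planeForm b v = 0) :
      fderiv ℂ g 0 v = 0 ∧ fderiv ℂ (fderiv ℂ g) 0 v v = 0 := by
    refine derivatives_eq_zero_of_eventually_line hg ?_
    have hlim : Filter.Tendsto (fun t : ℂ => t • v) (nhds 0) (nhds 0) := by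
      have : Continuous fun t : ℂ => t • v := by fun_prop
      simpa using this.tendsto 0
    have hsmul (c : Fin 7) (t : ℂ) : planeForm c (t • v) = t * planeForm c v := by
      simp [planeForm]; ring
    filter_upwards [hlim.eventually (hline a b hab hp)] with t ht
    exact ht (by simp [hsmul, ha]) (by simp [hsmul, hb])
  have hsymm (v w : Fin 3 → ℂ) :
      fderiv ℂ (fderiv ℂ g) 0 v w = fderiv ℂ (fderiv ℂ g) 0 w v :=
    second_derivative_symmetric_of_eventually (hg.mono fun y hy => hy.hasFDerivAt)
      (differentiableAt_fderiv hg).hasFDerivAt v w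
  set P := fderiv ℂ g 0
  set D := fderiv ℂ (fderiv ℂ g) 0
  let e : Fin 3 → Fin 3 → ℂ := fun i => Pi.single i 1
  have hv (s t : ℂ) : ![1, s, t] = e 0 + s • e 1 + t • e 2 := by
    ext i; fin_cases i <;> simp [e]
  have h0 := key 4 6 (by decide) (by decide) (e 0)
    (by simp [planeForm, planeCoeff, e]) (by simp [planeForm, planeCoeff, e])
  have h1 := key 2 6 (by decide) (by decide) (e 1)
    (by simp [planeForm, planeCoeff, e]) (by simp [planeForm, planeCoeff, e])
  have hpp := key 0 2 (by decide) (by decide) ![1, 1, 1]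
    (by simp [planeForm, planeCoeff]) (by simp [planeForm, planeCoeff])
  have hpm := key 0 3 (by decide) (by decide) ![1, 1, -1]
    (by simp [planeForm, planeCoeff]) (by simp [planeForm, planeCoeff])
  have hmp := key 1 2 (by decide) (by decide) ![1, -1, 1]
    (by simp [planeForm, planeCoeff]) (by simp [planeForm, planeCoeff])
  have hmm := key 1 3 (by decide) (by decide) ![1, -1, -1]
    (by simp [planeForm, planeCoeff]) (by simp [planeForm, planeCoeff])
  simp only [hv, map_add, map_smul, add_apply, smul_apply,
    smul_eq_mul, h0.1, h1.1, h0.2, h1.2, hsymm (e 1) (e 0), hsymm (e 2) (e 0),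
    hsymm (e 2) (e 1)] at hpp hpm hmp hmm
  have hP2 : P (e 2) = 0 := by linear_combination hpp.1
  have h01 : D (e 0) (e 1) = 0 := by
    linear_combination (hpp.2 + hpm.2 - hmp.2 - hmm.2) / 8
  have h02 : D (e 0) (e 2) = 0 := by
    linear_combination (hpp.2 - hpm.2 + hmp.2 - hmm.2) / 8
  have h12 : D (e 1) (e 2) = 0 := by
    linear_combination (hpp.2 - hpm.2 - hmp.2 + hmm.2) / 8
  have h22 : D (e 2) (e 2) = 0 := by
    linear_combination (hpp.2 + hpm.2 + hmp.2 + hmm.2) / 4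
  constructor
  · refine ContinuousLinearMap.coe_injective (LinearMap.pi_ext' fun i => LinearMap.ext_ring ?_)
    fin_cases i
    exacts [h0.1, h1.1, hP2]
  · refine ContinuousLinearMap.coe_injective (LinearMap.pi_ext' fun i => LinearMap.ext_ring ?_)
    refine ContinuousLinearMap.coe_injective (LinearMap.pi_ext' fun j => LinearMap.ext_ring ?_)
    change D (e i) (e j) = 0
    fin_cases i <;> fin_cases j
    exacts [h0.2, h01, h02, (hsymm _ _).trans h01, h1.2, h12, (hsymm _ _).trans h02,
      (hsymm _ _).trans h12, h22]

theorem exists_norm_fderiv_le {g : (Fin 3 → ℂ) → ℂ} {x : Fin 3 → ℂ}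
    (hg : ∀ᶠ y in nhds x, DifferentiableAt ℂ g y)
    (hline : ∀ a b, a ≠ b → (pencil a b).Nonempty →
      ∀ᶠ y in nhds x, planeForm a y = 0 → planeForm b y = 0 → g y = 0) :
    ∃ C : ℝ, 0 < C ∧ ∀ᶠ y in nhds x, ‖fderiv ℂ g y‖ ≤ C * ‖y‖ ^ 2 := by
  have hbd := (differentiableAt_fderiv hg).continuousAt.norm.eventually_le_const
    (lt_add_one ‖fderiv ℂ g x‖)
  rcases eq_or_ne x 0 with rfl | hx
  · obtain ⟨hP, hD⟩ := derivatives_eq_zero hg hline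
    have hdiff : ∀ᶠ y in nhds 0, DifferentiableAt ℂ (fderiv ℂ g) y :=
      hg.eventually_nhds.mono fun y hy => differentiableAt_fderiv hy
    obtain ⟨R, hR, hball⟩ := Metric.eventually_nhds_iff_ball.1 (hdiff.and hbd)
    rw [hP, norm_zero, zero_add] at hball
    refine ⟨1 / R ^ 2, by positivity, ?_⟩
    filter_upwards [Metric.ball_mem_nhds 0 hR] with y hy
    have h := Complex.dist_le_mul_div_pow_of_mapsTo_ball_of_isLittleO (n := 1) (R₂ := 1)
      (f := fderiv ℂ g) (c := 0) (fun y hy => (hball y hy).1.differentiableWithinAt)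
      (fun y hy => by rw [hP, mem_closedBall_zero_iff]; exact (hball y hy).2) ?_ hy
    · rw [hP, dist_zero_right, dist_zero_right] at h
      exact h.trans_eq (by ring)
    · have h := (differentiableAt_fderiv hg).hasFDerivAt.isLittleO
      rw [hD] at h
      simpa [hP] using h.norm_right
  · refine ⟨(‖fderiv ℂ g x‖ + 1) / (‖x‖ / 2) ^ 2, by positivity, ?_⟩
    have hx' : ‖x‖ / 2 < ‖x‖ := half_lt_self (norm_pos_iff.2 hx)
    filter_upwards [hbd, continuousAt_id.norm.eventually_const_le hx'] with y hy hxy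
    refine hy.trans ?_
    rw [div_mul_eq_mul_div, le_div_iff₀ (by positivity)]
    gcongr
    exact hxy

theorem exists_projection {a b : Fin 7} (h : a ≠ b) :
    ∃ (π : (Fin 3 → ℂ) →L[ℂ] (Fin 3 → ℂ)) (K : ℝ), 0 < K ∧
      (∀ y, planeForm a (π y) = 0 ∧ planeForm b (π y) = 0) ∧
      (∀ y, planeForm a y = 0 → planeForm b y = 0 → π y = y) ∧
      ∀ (y : Fin 3 → ℂ) (ε : ℝ), ‖planeForm a y‖ ≤ ε → ‖planeForm b y‖ ≤ ε →
        ‖y - π y‖ ≤ K * ε := by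
  obtain ⟨c, hc⟩ := exists_coeffDet_ne_zero h
  obtain ⟨Φ, hΦ⟩ := exists_coordinates hc
  obtain ⟨K, hK, hKy⟩ := exists_norm_le_of_coeffDet_ne_zero hc
  let π : (Fin 3 → ℂ) →L[ℂ] (Fin 3 → ℂ) := (Φ.symm : (Fin 3 → ℂ) →L[ℂ] (Fin 3 → ℂ)).comp
    ((ContinuousLinearMap.single ℂ (fun _ : Fin 3 => ℂ) 2).comp
      ((ContinuousLinearMap.proj 2).comp (Φ : (Fin 3 → ℂ) →L[ℂ] (Fin 3 → ℂ))))
  have hπ (y) : Φ (π y) = Pi.single 2 (planeForm c y) := by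
    have : π y = Φ.symm (Pi.single 2 (Φ y 2)) := rfl
    rw [this, Φ.apply_symm_apply, hΦ]
    simp
  have hπ0 (y) : planeForm a (π y) = 0 := by simpa [hΦ] using congrFun (hπ y) 0
  have hπ1 (y) : planeForm b (π y) = 0 := by simpa [hΦ] using congrFun (hπ y) 1
  have hπ2 (y) : planeForm c (π y) = planeForm c y := by simpa [hΦ] using congrFun (hπ y) 2
  refine ⟨π, K, hK, fun y => ⟨hπ0 y, hπ1 y⟩, fun y ha hb => Φ.injective ?_, fun y ε ha hb => ?_⟩
  · rw [hΦ, hΦ, hπ0, hπ1, hπ2, ha, hb]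
  · have hsub (i : Fin 7) : planeForm i (y - π y) = planeForm i y - planeForm i (π y) := by
      simp [planeForm]; ring
    refine hKy _ _ ?_ ?_ ?_
    · rwa [hsub, hπ0, sub_zero]
    · rwa [hsub, hπ1, sub_zero]
    · rw [hsub, hπ2, sub_self, norm_zero]
      exact (norm_nonneg _).trans ha

/-- A function vanishing on the triple lines is bounded by `‖y‖ ^ 2` times the distance to each
triple line, at the origin as well as elsewhere. -/
theorem exists_norm_le_of_vanishing {g : (Fin 3 → ℂ) → ℂ} {x : Fin 3 → ℂ}
    (hg : ∀ᶠ y in nhds x, DifferentiableAt ℂ g y)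
    (hline : ∀ a b, a ≠ b → (pencil a b).Nonempty →
      ∀ᶠ y in nhds x, planeForm a y = 0 → planeForm b y = 0 → g y = 0)
    {a b : Fin 7} (hab : a ≠ b) (hp : (pencil a b).Nonempty) :
    ∃ C : ℝ, 0 < C ∧ ∀ᶠ y in nhds x, ∀ ε, ‖planeForm a y‖ ≤ ε → ‖planeForm b y‖ ≤ ε →
      ‖g y‖ ≤ C * ‖y‖ ^ 2 * ε := by
  by_cases hx : planeForm a x = 0 ∧ planeForm b x = 0
  · obtain ⟨C, hC, hfd⟩ := exists_norm_fderiv_le hg hline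
    obtain ⟨π, K, hK, hπ0, hπ1, hπK⟩ := exists_projection hab
    obtain ⟨R, hR, hball⟩ := Metric.eventually_nhds_iff_ball.1 (hg.and (hfd.and (hline a b hab hp)))
    have hπlim : Filter.Tendsto π (nhds x) (nhds x) := by
      simpa [hπ1 x hx.1 hx.2] using π.continuous.tendsto x
    refine ⟨C * (1 + ‖π‖) ^ 2 * K, by positivity, ?_⟩
    filter_upwards [Metric.ball_mem_nhds x hR, hπlim (Metric.ball_mem_nhds x hR)]
      with y hy hπy ε ha hb
    have hseg : segment ℝ (π y) y ⊆ Metric.ball x R := (convex_ball x R).segment_subset hπy hy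
    have hnorm : ∀ z ∈ segment ℝ (π y) y, ‖z‖ ≤ (1 + ‖π‖) * ‖y‖ := by
      intro z hz
      have h1 := π.le_opNorm y
      have h2 : segment ℝ (π y) y ⊆ Metric.closedBall 0 ((1 + ‖π‖) * ‖y‖) := by
        refine (convex_closedBall _ _).segment_subset ?_ ?_ <;> rw [mem_closedBall_zero_iff] <;>
          nlinarith [norm_nonneg y, norm_nonneg π]
      simpa using h2 hz
    have h := (convex_segment (π y) y).norm_image_sub_le_of_norm_fderiv_le (𝕜 := ℂ) (f := g)
      (C := C * ((1 + ‖π‖) * ‖y‖) ^ 2) (fun z hz => (hball z (hseg hz)).1)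
      (fun z hz => (hball z (hseg hz)).2.1.trans (by gcongr; exact hnorm z hz))
      (left_mem_segment _ _ _) (right_mem_segment _ _ _)
    rw [(hball _ hπy).2.2 (hπ0 y).1 (hπ0 y).2, sub_zero] at h
    calc ‖g y‖ ≤ _ := h
      _ ≤ C * ((1 + ‖π‖) * ‖y‖) ^ 2 * (K * ε) := by gcongr; exact hπK y ε ha hb
      _ = _ := by ring
  · have hx0 : x ≠ 0 := by
      rintro rfl
      simp [planeForm] at hx
    set d := max ‖planeForm a x‖ ‖planeForm b x‖ with hd
    have hd0 : 0 < d := by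
      rw [hd, lt_max_iff, norm_pos_iff, norm_pos_iff]
      tauto
    have hdlim := ((continuous_planeForm a).norm.max (continuous_planeForm b).norm).continuousAt
      (x := x) |>.eventually_const_le (half_lt_self hd0)
    have hx' : 0 < ‖x‖ := norm_pos_iff.2 hx0
    refine ⟨(‖g x‖ + 1) / ((‖x‖ / 2) ^ 2 * (d / 2)), by positivity, ?_⟩
    filter_upwards [hdlim, continuousAt_id.norm.eventually_const_le (half_lt_self hx'),
      hg.self_of_nhds.continuousAt.norm.eventually_le_const (lt_add_one ‖g x‖)]
      with y h1 h2 h3 ε ha hb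
    have h4 : d / 2 ≤ ε := h1.trans (max_le ha hb)
    have h5 : ‖x‖ / 2 ≤ ‖y‖ := h2
    refine h3.trans ?_
    rw [mul_assoc, div_mul_eq_mul_div, le_div_iff₀ (by positivity)]
    gcongr

theorem ae_exampleF_ne_zero : ∀ᵐ y : Fin 3 → ℂ, exampleF y ≠ 0 := by
  have hsq : ∀ c, planeCoeff c 0 * planeCoeff c 0 + planeCoeff c 1 * planeCoeff c 1 +
      planeCoeff c 2 * planeCoeff c 2 ≠ 0 := by decide
  have h (c : Fin 7) : ∀ᵐ y : Fin 3 → ℂ, planeForm c y ≠ 0 := by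
    let S : Submodule ℝ (Fin 3 → ℂ) :=
      { carrier := {y | planeForm c y = 0}
        add_mem' := fun {u v} hu hv => by
          simp only [Set.mem_ofPred_eq, planeForm, Pi.add_apply] at *
          linear_combination hu + hv
        zero_mem' := by simp [planeForm]
        smul_mem' := fun t u hu => by
          simp only [Set.mem_ofPred_eq, planeForm, Pi.smul_apply, Complex.real_smul] at *
          linear_combination t * hu }
    have hS : S ≠ ⊤ := by
      intro h
      have h1 : (fun k => (planeCoeff c k : ℂ)) ∈ S := h ▸ Submodule.mem_top
      have h2 : planeForm c (fun k => (planeCoeff c k : ℂ)) = 0 := h1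
      have h3 : planeCoeff c 0 * planeCoeff c 0 + planeCoeff c 1 * planeCoeff c 1 +
          planeCoeff c 2 * planeCoeff c 2 = 0 := by
        simp only [planeForm] at h2
        exact_mod_cast h2
      exact hsq c h3
    have h0 : volume {y : Fin 3 → ℂ | planeForm c y = 0} = 0 :=
      Measure.addHaar_submodule volume S hS
    simpa [ae_iff] using h0
  filter_upwards [ae_all_iff.2 h] with y hy
  rw [← norm_ne_zero_iff, norm_exampleF]
  exact Finset.prod_ne_zero_iff.2 fun c _ => norm_ne_zero_iff.2 (hy c)

theorem norm_exampleF_le_of_pencil {a b : Fin 7} (hab : a ≠ b) (hp : (pencil a b).Nonempty)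
    {y : Fin 3 → ℂ} {ε R : ℝ} (ha : ‖planeForm a y‖ ≤ ε) (hb : ‖planeForm b y‖ ≤ ε)
    (hR : ‖y‖ ≤ R) : ‖exampleF y‖ ≤ 4 * (3 * R) ^ 4 * ε ^ 3 := by
  obtain ⟨h1, h2⟩ := (card_pencil hab).resolve_left fun h => hp.card_ne_zero h.1
  have hε : 0 ≤ ε := (norm_nonneg _).trans ha
  have hpen : ∏ c ∈ pencil a b, ‖planeForm c y‖ ≤ ∏ c ∈ pencil a b, 4 * ε :=
    Finset.prod_le_prod (fun _ _ => norm_nonneg _)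
      fun c hc => norm_planeForm_le_of_mem_pencil hab hc ha hb
  have hcop : ∏ c ∈ coPencil a b, ‖planeForm c y‖ ≤ ∏ c ∈ coPencil a b, 3 * R :=
    Finset.prod_le_prod (fun _ _ => norm_nonneg _)
      fun c _ => (norm_planeForm_le c y).trans (by gcongr)
  rw [Finset.prod_const, h1] at hpen
  rw [Finset.prod_const, h2] at hcop
  rw [norm_exampleF, prod_split hab]
  calc _ ≤ ε * ε * ((4 * ε) ^ 1 * (3 * R) ^ 4) := by gcongr
    _ = _ := by ring

theorem eq_zero_of_integrableOn {g : (Fin 3 → ℂ) → ℂ} {p : Fin 3 → ℂ} (hg : ContinuousAt g p)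
    {W : Set (Fin 3 → ℂ)} (hW : W ∈ nhds p)
    (hgint : IntegrableOn (fun y => ‖g y‖ ^ 2 * ‖exampleF y‖ ^ (-2 * (7 / 10) : ℝ)) W)
    {a b : Fin 7} (hab : a ≠ b) (hp : (pencil a b).Nonempty)
    (ha : planeForm a p = 0) (hb : planeForm b p = 0) : g p = 0 := by
  by_contra hgp
  have hgp' : 0 < ‖g p‖ := norm_pos_iff.2 hgp
  obtain ⟨c, hc⟩ := exists_coeffDet_ne_zero hab
  obtain ⟨Φ, hΦ⟩ := exists_coordinates hc
  have h0 (y) : Φ y 0 = planeForm a y := by simp [hΦ]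
  have h1 (y) : Φ y 1 = planeForm b y := by simp [hΦ]
  have hW' := Filter.inter_mem hW ((hg.norm.eventually_const_le (half_lt_self hgp')).and
    (continuousAt_id.norm.eventually_le_const (lt_add_one ‖p‖)))
  set A : ℝ := 4 * (3 * (‖p‖ + 1)) ^ 4 with hA
  have hA0 : 0 < A := by positivity
  refine not_integrableOn_of_rpow_le Φ ((h0 p).trans ha) ((h1 p).trans hb) hW' (τ := 21 / 5)
    (c := (‖g p‖ / 2) ^ 2 * A ^ (-2 * (7 / 10) : ℝ)) (fun y => by positivity) (by positivity)
    (by norm_num) ?_ (hgint.mono_set Set.inter_subset_left)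
  filter_upwards [ae_exampleF_ne_zero] with y hfy hy ε hε ha hb
  rw [h0] at ha
  rw [h1] at hb
  have hf := norm_exampleF_le_of_pencil hab hp ha hb hy.2.2
  have hpow := Real.rpow_le_rpow_of_nonpos (norm_pos_iff.2 hfy) hf
    (show (-2 * (7 / 10) : ℝ) ≤ 0 by norm_num)
  rw [← hA, Real.mul_rpow hA0.le (by positivity), ← Real.rpow_natCast ε 3, ← Real.rpow_mul hε.le,
    show ((3 : ℕ) : ℝ) * (-2 * (7 / 10)) = -(21 / 5) by norm_num] at hpow
  rw [mul_assoc]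
  gcongr
  exact hy.2.1

theorem eventually_eq_zero_of_integrableOn {g : (Fin 3 → ℂ) → ℂ} {x : Fin 3 → ℂ}
    (hg : ∀ᶠ y in nhds x, DifferentiableAt ℂ g y) {W : Set (Fin 3 → ℂ)} (hW : W ∈ nhds x)
    (hgint : IntegrableOn (fun y => ‖g y‖ ^ 2 * ‖exampleF y‖ ^ (-2 * (7 / 10) : ℝ)) W)
    {a b : Fin 7} (hab : a ≠ b) (hp : (pencil a b).Nonempty) :
    ∀ᶠ y in nhds x, planeForm a y = 0 → planeForm b y = 0 → g y = 0 := by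
  filter_upwards [hg, eventually_mem_nhds_iff.2 hW] with y hy hWy ha hb
  exact eq_zero_of_integrableOn hy.continuousAt hWy hgint hab hp ha hb

theorem exists_uniform_norm_le : ∃ K : ℝ, 1 ≤ K ∧ ∀ a b c, coeffDet a b c ≠ 0 →
    ∀ (y : Fin 3 → ℂ) (ε : ℝ), ‖planeForm a y‖ ≤ ε → ‖planeForm b y‖ ≤ ε →
      ‖planeForm c y‖ ≤ ε → ‖y‖ ≤ K * ε := by
  have h (t : Fin 7 × Fin 7 × Fin 7) : ∃ K : ℝ, 0 < K ∧ (coeffDet t.1 t.2.1 t.2.2 ≠ 0 →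
      ∀ (y : Fin 3 → ℂ) (ε : ℝ), ‖planeForm t.1 y‖ ≤ ε → ‖planeForm t.2.1 y‖ ≤ ε →
        ‖planeForm t.2.2 y‖ ≤ ε → ‖y‖ ≤ K * ε) := by
    by_cases ht : coeffDet t.1 t.2.1 t.2.2 = 0
    · exact ⟨1, one_pos, fun h => absurd ht h⟩
    · obtain ⟨K, hK, hy⟩ := exists_norm_le_of_coeffDet_ne_zero ht
      exact ⟨K, hK, fun _ => hy⟩
  choose K hK hy using h
  refine ⟨1 + ∑ t, K t, le_add_of_nonneg_right (Finset.sum_nonneg fun t _ => (hK t).le),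
    fun a b c hdet y ε ha hb hc => (hy (a, b, c) hdet y ε ha hb hc).trans ?_⟩
  have hle := Finset.single_le_sum (fun t _ => (hK t).le) (Finset.mem_univ (a, b, c))
  exact mul_le_mul_of_nonneg_right (by linarith) ((norm_nonneg _).trans ha)

theorem exists_uniform_norm_le_of_vanishing {g : (Fin 3 → ℂ) → ℂ} {x : Fin 3 → ℂ}
    (hg : ∀ᶠ y in nhds x, DifferentiableAt ℂ g y)
    (hline : ∀ a b, a ≠ b → (pencil a b).Nonempty →
      ∀ᶠ y in nhds x, planeForm a y = 0 → planeForm b y = 0 → g y = 0) :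
    ∃ C : ℝ, 0 < C ∧ ∀ᶠ y in nhds x, ∀ a b, a ≠ b → (pencil a b).Nonempty →
      ∀ ε, ‖planeForm a y‖ ≤ ε → ‖planeForm b y‖ ≤ ε → ‖g y‖ ≤ C * ‖y‖ ^ 2 * ε := by
  have h (t : Fin 7 × Fin 7) : ∃ C : ℝ, 0 < C ∧ ∀ᶠ y in nhds x, t.1 ≠ t.2 →
      (pencil t.1 t.2).Nonempty → ∀ ε, ‖planeForm t.1 y‖ ≤ ε → ‖planeForm t.2 y‖ ≤ ε →
        ‖g y‖ ≤ C * ‖y‖ ^ 2 * ε := by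
    by_cases ht : t.1 ≠ t.2 ∧ (pencil t.1 t.2).Nonempty
    · obtain ⟨C, hC, hy⟩ := exists_norm_le_of_vanishing hg hline ht.1 ht.2
      exact ⟨C, hC, hy.mono fun y hy _ _ => hy⟩
    · exact ⟨1, one_pos, Filter.Eventually.of_forall fun y h1 h2 => absurd ⟨h1, h2⟩ ht⟩
  choose C hC hy using h
  refine ⟨∑ t, C t, Finset.sum_pos (fun t _ => hC t) Finset.univ_nonempty, ?_⟩
  filter_upwards [Filter.eventually_all.2 hy] with y hy a b hab hp ε ha hb
  have hle := Finset.single_le_sum (fun t _ => (hC t).le) (Finset.mem_univ (a, b))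
  have hε : 0 ≤ ε := (norm_nonneg _).trans ha
  exact (hy (a, b) hab hp ε ha hb).trans (by gcongr)

theorem sq_mul_rpow_le {G F P D : ℝ} (hF : 0 < F) (hP : 0 < P) (hD : 0 ≤ D)
    (h : G ^ 14 * P ^ 12 ≤ D * F ^ 10) :
    G ^ 2 * F ^ (-(10 : ℝ) / 7) ≤ D ^ ((1 : ℝ) / 7) * P ^ (-(12 / 7 : ℝ)) := by
  refine le_of_pow_le_pow_left₀ (n := 7) (by norm_num) (by positivity) ?_
  have h1 : (F ^ (-(10 : ℝ) / 7)) ^ 7 = (F ^ 10)⁻¹ := by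
    rw [← Real.rpow_natCast, ← Real.rpow_mul hF.le, ← Real.rpow_natCast F 10, ← Real.rpow_neg hF.le]
    norm_num
  have h2 : (P ^ (-(12 / 7 : ℝ))) ^ 7 = (P ^ 12)⁻¹ := by
    rw [← Real.rpow_natCast, ← Real.rpow_mul hP.le, ← Real.rpow_natCast P 12, ← Real.rpow_neg hP.le]
    norm_num
  have h3 : (D ^ ((1 : ℝ) / 7)) ^ 7 = D := by
    rw [← Real.rpow_natCast, ← Real.rpow_mul hD]
    norm_num
  rw [mul_pow, mul_pow, h1, h2, h3, ← pow_mul, ← div_eq_mul_inv, ← div_eq_mul_inv,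
    div_le_div_iff₀ (by positivity) (by positivity)]
  exact h

theorem pow_mul_pow_le_of_cubic {A B N G F C K ρ : ℝ} (hA0 : 0 ≤ A) (hB0 : 0 ≤ B) (hN0 : 0 ≤ N)
    (hG0 : 0 ≤ G) (hA : A ≤ ρ) (hB : B ≤ ρ) (hN : N ≤ ρ) (hG : G ≤ C * N ^ 3)
    (hF : A * B * N ^ 5 ≤ K ^ 5 * F) :
    G ^ 14 * (A * B * N) ^ 12 ≤ C ^ 14 * ρ ^ 8 * (K ^ 5 * F) ^ 10 := by
  have hρ : 0 ≤ ρ := hA0.trans hA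
  have h1 : G ^ 14 ≤ (C * N ^ 3) ^ 14 := pow_le_pow_left₀ hG0 hG 14
  have h2 : (A * B * N ^ 5) ^ 10 ≤ (K ^ 5 * F) ^ 10 := pow_le_pow_left₀ (by positivity) hF 10
  have h3 : A ^ 2 * B ^ 2 * N ^ 4 ≤ ρ ^ 2 * ρ ^ 2 * ρ ^ 4 := by gcongr
  calc G ^ 14 * (A * B * N) ^ 12 ≤ (C * N ^ 3) ^ 14 * (A * B * N) ^ 12 :=
        mul_le_mul_of_nonneg_right h1 (by positivity)
    _ = C ^ 14 * (A ^ 2 * B ^ 2 * N ^ 4) * (A * B * N ^ 5) ^ 10 := by ring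
    _ ≤ C ^ 14 * (ρ ^ 2 * ρ ^ 2 * ρ ^ 4) * (K ^ 5 * F) ^ 10 :=
        mul_le_mul (mul_le_mul_of_nonneg_left h3 (by positivity)) h2 (by positivity)
          (by positivity)
    _ = C ^ 14 * ρ ^ 8 * (K ^ 5 * F) ^ 10 := by rw [← pow_add, ← pow_add]

theorem pow_mul_pow_le_of_pencil {A B N G F C K ρ : ℝ} (hA0 : 0 ≤ A) (hB0 : 0 ≤ B)
    (hG0 : 0 ≤ G) (hA : A ≤ ρ) (hB : B ≤ ρ) (hG : G ≤ C * N ^ 2 * B)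
    (hF : A * B * (B * N ^ 4) ≤ K ^ 5 * F) :
    G ^ 14 * (A * B * N) ^ 12 ≤ C ^ 14 * ρ ^ 8 * (K ^ 5 * F) ^ 10 := by
  have hρ : 0 ≤ ρ := hA0.trans hA
  have h1 : G ^ 14 ≤ (C * N ^ 2 * B) ^ 14 := pow_le_pow_left₀ hG0 hG 14
  have h2 : (A * B * (B * N ^ 4)) ^ 10 ≤ (K ^ 5 * F) ^ 10 := pow_le_pow_left₀ (by positivity) hF 10
  have h3 : A ^ 2 * B ^ 6 ≤ ρ ^ 2 * ρ ^ 6 := by gcongr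
  calc G ^ 14 * (A * B * N) ^ 12 ≤ (C * N ^ 2 * B) ^ 14 * (A * B * N) ^ 12 :=
        mul_le_mul_of_nonneg_right h1 (by positivity)
    _ = C ^ 14 * (A ^ 2 * B ^ 6) * (A * B * (B * N ^ 4)) ^ 10 := by ring
    _ ≤ C ^ 14 * (ρ ^ 2 * ρ ^ 6) * (K ^ 5 * F) ^ 10 :=
        mul_le_mul (mul_le_mul_of_nonneg_left h3 (by positivity)) h2 (by positivity)
          (by positivity)
    _ = C ^ 14 * ρ ^ 8 * (K ^ 5 * F) ^ 10 := by rw [← pow_add]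

/-- If `a` and `b` are the two planes closest to `y`, then the pole of `|f| ^ (-10 / 7)`,
compensated by the vanishing of `g`, is at most of order `12 / 7` in each of `a`, `b` and `y`. -/
theorem pow_mul_pow_le {C K R G : ℝ} (hC : 0 < C) (hK : 1 ≤ K) (hG : 0 ≤ G)
    {a b : Fin 7} (hab : a ≠ b) {y : Fin 3 → ℂ} (hyR : ‖y‖ ≤ R)
    (hKy : ∀ c, coeffDet a b c ≠ 0 → ∀ ε, ‖planeForm a y‖ ≤ ε → ‖planeForm b y‖ ≤ ε →
      ‖planeForm c y‖ ≤ ε → ‖y‖ ≤ K * ε)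
    (hmin : ‖planeForm a y‖ ≤ ‖planeForm b y‖)
    (hmin' : ∀ c, c ≠ a → ‖planeForm b y‖ ≤ ‖planeForm c y‖)
    (hG3 : G ≤ 3 * C * ‖y‖ ^ 3)
    (hGb : (pencil a b).Nonempty → G ≤ C * ‖y‖ ^ 2 * ‖planeForm b y‖) :
    G ^ 14 * (‖planeForm a y‖ * ‖planeForm b y‖ * ‖y‖) ^ 12 ≤
      (3 * C) ^ 14 * (3 * R) ^ 8 * (K ^ 5 * ‖exampleF y‖) ^ 10 := by
  have hK0 : 0 < K := by linarith
  have hcop : ∏ c ∈ coPencil a b, ‖y‖ / K ≤ ∏ c ∈ coPencil a b, ‖planeForm c y‖ := by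
    refine Finset.prod_le_prod (fun _ _ => by positivity) fun c hc => ?_
    simp only [coPencil, Finset.mem_filter, Finset.mem_univ, true_and] at hc
    rw [div_le_iff₀' hK0]
    have hbc := hmin' c hc.1.1
    exact hKy c hc.2 _ (hmin.trans hbc) hbc le_rfl
  have hpen : ∏ c ∈ pencil a b, ‖planeForm b y‖ ≤ ∏ c ∈ pencil a b, ‖planeForm c y‖ := by
    refine Finset.prod_le_prod (fun _ _ => norm_nonneg _) fun c hc => ?_
    simp only [pencil, Finset.mem_filter, Finset.mem_univ, true_and] at hc
    exact hmin' c hc.1.1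
  have hf : ‖planeForm a y‖ * ‖planeForm b y‖ * (‖planeForm b y‖ ^ (pencil a b).card *
      (‖y‖ / K) ^ (coPencil a b).card) ≤ ‖exampleF y‖ := by
    rw [norm_exampleF, prod_split hab]
    rw [Finset.prod_const] at hcop hpen
    exact mul_le_mul_of_nonneg_left (mul_le_mul hpen hcop (by positivity)
      (Finset.prod_nonneg fun _ _ => norm_nonneg _)) (by positivity)
  have hA : ‖planeForm a y‖ ≤ 3 * R := (norm_planeForm_le a y).trans (by gcongr)
  have hB : ‖planeForm b y‖ ≤ 3 * R := (norm_planeForm_le b y).trans (by gcongr)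
  have hN : ‖y‖ ≤ 3 * R := by linarith [norm_nonneg y]
  rcases card_pencil hab with ⟨h1, h2⟩ | ⟨h1, h2⟩
  · rw [h1, h2, pow_zero, one_mul, div_pow, ← mul_div_assoc, div_le_iff₀' (by positivity)] at hf
    exact pow_mul_pow_le_of_cubic (norm_nonneg _) (norm_nonneg _) (norm_nonneg _) hG hA hB hN
      hG3 hf
  · rw [h1, h2, pow_one, div_pow, ← mul_div_assoc, ← mul_div_assoc,
      div_le_iff₀' (by positivity)] at hf
    have hp : (pencil a b).Nonempty := Finset.card_pos.1 (by omega)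
    have hK45 : K ^ 4 ≤ K ^ 5 := pow_le_pow_right₀ hK (by norm_num)
    refine pow_mul_pow_le_of_pencil (norm_nonneg _) (norm_nonneg _) hG hA hB
      ((hGb hp).trans ?_) (hf.trans (mul_le_mul_of_nonneg_right hK45 (norm_nonneg _)))
    gcongr
    linarith

theorem exists_coordinates_of_pair :
    ∃ Φ : Fin 7 × Fin 7 → ((Fin 3 → ℂ) ≃L[ℂ] (Fin 3 → ℂ)), ∀ a b, a ≠ b →
      ∃ m, ∀ y, Φ (a, b) y = ![planeForm a y, planeForm b y, planeForm m y] := by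
  have h (t : Fin 7 × Fin 7) : ∃ Φ : (Fin 3 → ℂ) ≃L[ℂ] (Fin 3 → ℂ), t.1 ≠ t.2 →
      ∃ m, ∀ y, Φ y = ![planeForm t.1 y, planeForm t.2 y, planeForm m y] := by
    by_cases ht : t.1 = t.2
    · exact ⟨.refl ℂ _, fun h => absurd ht h⟩
    · obtain ⟨m, hm⟩ := exists_coeffDet_ne_zero ht
      obtain ⟨Φ, hΦ⟩ := exists_coordinates hm
      exact ⟨Φ, fun _ => ⟨m, hΦ⟩⟩
  choose Φ hΦ using h
  exact ⟨Φ, fun a b hab => hΦ (a, b) hab⟩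

theorem exists_two_smallest {α : Type*} [Fintype α] [DecidableEq α] [Nontrivial α] (w : α → ℝ) :
    ∃ a b, a ≠ b ∧ w a ≤ w b ∧ ∀ c, c ≠ a → w b ≤ w c := by
  obtain ⟨a, ha⟩ := Finite.exists_min w
  obtain ⟨c, hc⟩ := exists_ne a
  obtain ⟨b, hb, hmin⟩ := Finset.exists_min_image (Finset.univ.erase a) w
    ⟨c, Finset.mem_erase.2 ⟨hc, Finset.mem_univ c⟩⟩
  exact ⟨a, b, (Finset.ne_of_mem_erase hb).symm, ha b,
    fun c hc => hmin c (Finset.mem_erase.2 ⟨hc, Finset.mem_univ c⟩)⟩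

theorem exists_integrableOn_of_vanishing {g : (Fin 3 → ℂ) → ℂ} {x : Fin 3 → ℂ}
    (hg : ∀ᶠ y in nhds x, DifferentiableAt ℂ g y)
    (hline : ∀ a b, a ≠ b → (pencil a b).Nonempty →
      ∀ᶠ y in nhds x, planeForm a y = 0 → planeForm b y = 0 → g y = 0) :
    ∃ W ∈ nhds x, IntegrableOn (fun y => ‖g y‖ ^ 2 * ‖exampleF y‖ ^ (-(10 : ℝ) / 7)) W := by
  obtain ⟨K, hK, hKy⟩ := exists_uniform_norm_le
  obtain ⟨C, hC, hCy⟩ := exists_uniform_norm_le_of_vanishing hg hline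
  obtain ⟨Φ, hΦ⟩ := exists_coordinates_of_pair
  set R := ‖x‖ + 1 with hR
  have hR0 : 0 < R := by positivity
  set D : ℝ := (3 * C) ^ 14 * (3 * R) ^ 8 * K ^ 50 * 3 ^ 12 with hD
  have hD0 : 0 ≤ D := by positivity
  obtain ⟨r, hr, hball⟩ := Metric.eventually_nhds_iff_ball.1
    (hg.and (hCy.and (continuousAt_id.norm.eventually_lt_const (lt_add_one ‖x‖))))
  refine ⟨Metric.ball x r, Metric.ball_mem_nhds x hr, ?_⟩
  have hdom : IntegrableOn (fun y => ∑ t, D ^ ((1 : ℝ) / 7) * ∏ i, ‖Φ t y i‖ ^ (-(12 / 7 : ℝ)))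
      (Metric.ball 0 R) :=
    integrable_finsetSum _ fun t _ =>
      (integrableOn_prod_norm_rpow (s := 12 / 7) (Φ t) (by norm_num) R).const_mul _
  replace hdom := hdom.mono_set
    fun y (hy : y ∈ Metric.ball x r) => mem_ball_zero_iff.2 (hball y hy).2.2
  refine hdom.mono' ?_ ?_
  · have h1 : AEStronglyMeasurable g (volume.restrict (Metric.ball x r)) :=
      ContinuousOn.aestronglyMeasurable
        (fun y hy => (hball y hy).1.continuousAt.continuousWithinAt) measurableSet_ball
    have h2 : Measurable fun y => ‖exampleF y‖ ^ (-(10 : ℝ) / 7) := by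
      unfold exampleF
      fun_prop
    exact (h1.norm.pow 2).mul h2.aestronglyMeasurable
  filter_upwards [ae_restrict_mem measurableSet_ball] with y hy
  obtain ⟨-, hCy, hyR⟩ := hball y hy
  have hyR' : ‖y‖ ≤ R := le_of_lt hyR
  rw [Real.norm_of_nonneg (by positivity)]
  by_cases hfy : exampleF y = 0
  · rw [hfy, norm_zero, Real.zero_rpow (by norm_num), mul_zero]
    positivity
  have hform : ∀ c, 0 < ‖planeForm c y‖ := by
    have h := norm_ne_zero_iff.2 hfy
    rw [norm_exampleF, Finset.prod_ne_zero_iff] at h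
    exact fun c => (norm_nonneg _).lt_of_ne' (h c (Finset.mem_univ c))
  obtain ⟨a, b, hab, hmin, hmin'⟩ := exists_two_smallest fun c => ‖planeForm c y‖
  have hG3 : ‖g y‖ ≤ 3 * C * ‖y‖ ^ 3 :=
    (hCy 0 2 (by decide) (by decide) _ (norm_planeForm_le 0 y) (norm_planeForm_le 2 y)).trans_eq
      (by ring)
  have hmain := pow_mul_pow_le hC hK (norm_nonneg (g y)) hab hyR'
    (fun c hc ε => hKy a b c hc y ε) hmin hmin' hG3 fun hp => hCy a b hab hp _ hmin le_rfl
  obtain ⟨m, hm⟩ := hΦ a b hab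
  have hpow : ‖g y‖ ^ 14 * (∏ i, ‖Φ (a, b) y i‖) ^ 12 ≤ D * ‖exampleF y‖ ^ 10 := by
    have h1 : ∏ i, ‖Φ (a, b) y i‖ ≤ ‖planeForm a y‖ * ‖planeForm b y‖ * (3 * ‖y‖) := by
      simp only [hm, Fin.prod_univ_three]
      exact mul_le_mul_of_nonneg_left (norm_planeForm_le m y) (by positivity)
    calc _ ≤ ‖g y‖ ^ 14 * (‖planeForm a y‖ * ‖planeForm b y‖ * (3 * ‖y‖)) ^ 12 := by gcongr
      _ = ‖g y‖ ^ 14 * (‖planeForm a y‖ * ‖planeForm b y‖ * ‖y‖) ^ 12 * 3 ^ 12 := by ring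
      _ ≤ _ := mul_le_mul_of_nonneg_right hmain (by positivity)
      _ = _ := by rw [hD]; ring
  have hP : 0 < ∏ i, ‖Φ (a, b) y i‖ := by
    simp only [hm, Fin.prod_univ_three]
    exact mul_pos (mul_pos (hform a) (hform b)) (hform m)
  refine (sq_mul_rpow_le (norm_pos_iff.2 hfy) hP hD0 hpow).trans ?_
  rw [← Real.finsetProd_rpow _ _ fun i _ => norm_nonneg _]
  exact Finset.single_le_sum (f := fun t => D ^ ((1 : ℝ) / 7) * ∏ i, ‖Φ t y i‖ ^ (-(12 / 7 : ℝ)))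
    (fun t _ => by positivity) (Finset.mem_univ (a, b))

/-- **Example 3.6.** `5/7` is not a jumping coefficient of the arrangement defined by
`f = (x²−y²)(x²−z²)(y²−z²)z`: whenever `g` is holomorphic near a point `x` and
`|g|²·|f|^(−2β)` is locally integrable at `x` for every `β ∈ (0, 5/7)`, also
`|g|²·|f|^(−10/7)` is integrable on some neighborhood of `x`. -/
theorem five_sevenths_not_jumping :
    ∀ (x : Fin 3 → ℂ) (U : Set (Fin 3 → ℂ)) (g : (Fin 3 → ℂ) → ℂ),
      U ∈ nhds x → DifferentiableOn ℂ g U →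
      (∀ β : ℝ, 0 < β → β < 5 / 7 →
        ∃ W ∈ nhds x,
          IntegrableOn (fun y => ‖g y‖ ^ 2 * ‖exampleF y‖ ^ (-2 * β)) W) →
      ∃ W ∈ nhds x,
        IntegrableOn (fun y => ‖g y‖ ^ 2 * ‖exampleF y‖ ^ (-(10 : ℝ) / 7)) W := by
  intro x U g hU hg h
  have hd : ∀ᶠ y in nhds x, DifferentiableAt ℂ g y := hg.eventually_differentiableAt hU
  obtain ⟨W, hW, hgint⟩ := h (7 / 10) (by norm_num) (by norm_num)
  exact exists_integrableOn_of_vanishing hd fun a b hab hp =>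
    eventually_eq_zero_of_integrableOn hd hW hgint hab hp
end
end
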